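/- arXiv:2303.16332 — 4 statements merged into one kernel-verified Lean document; each statement's English description precedes it below -/
import Mathlib

section
/- Let β ∈ Φ⁺ be a positive root and let β = s_{i_r}⋯s_{i_1}(α_j) be a positive expression for β. Then the set of shards of β^⊥ equals the set of those subsets of V* of the form σ_{i_r}^{ε_r}⋯σ_{i_2}^{ε_2}σ_{i_1}^{ε_1}(α_j^⊥), over all independent choices of signs ε_1, …, ε_r ∈ {+, −}, whose linear span in V* has dimension n − 1. -/
/-!
Setup: a symmetrizable crystallographic Cartan matrix `A` with symmetrizers `d`,
the vector space `V = Fin n → ℝ` with standard basis `α i = Pi.single i 1`,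
the bilinear form `(α i, α j) = d i * A i j`, the simple reflections
`s i (x) = x - (dᵢ⁻¹ αᵢ, x) αᵢ`, the group `W` generated by them (elements of
which are represented as products of lists of simple reflections), and the
set of real roots `Φ = { w (α i) }`.
-/

open Finset

noncomputable section

/-- The simple root `α i`, i.e. the `i`-th standard basis vector of `ℝⁿ`. -/
def sroot (n : ℕ) (i : Fin n) : Fin n → ℝ := Pi.single i 1

/-- The symmetric bilinear form with `(α i, α j) = d i * A i j`. -/
def formL (n : ℕ) (d : Fin n → ℤ) (A : Fin n → Fin n → ℤ) :
    (Fin n → ℝ) →ₗ[ℝ] (Fin n → ℝ) →ₗ[ℝ] ℝ :=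
  ∑ i : Fin n, ∑ j : Fin n,
    ((d i * A i j : ℤ) : ℝ) •
      LinearMap.smulRight (LinearMap.proj i : (Fin n → ℝ) →ₗ[ℝ] ℝ)
        (LinearMap.proj j : (Fin n → ℝ) →ₗ[ℝ] ℝ)

/-- The simple reflection `s i`, given by `s i x = x - (dᵢ⁻¹ • αᵢ, x) • αᵢ`. -/
def simpleRefl (n : ℕ) (d : Fin n → ℤ) (A : Fin n → Fin n → ℤ) (i : Fin n) :
    Module.End ℝ (Fin n → ℝ) :=
  LinearMap.id - ((d i : ℝ)⁻¹) • (formL n d A (sroot n i)).smulRight (sroot n i)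

/-- The element `s i_r * ⋯ * s i_1` of `W` corresponding to the list `l = [i_1, …, i_r]`
(the reflection `s i_1` is applied first). -/
def wprod (n : ℕ) (d : Fin n → ℤ) (A : Fin n → Fin n → ℤ) (l : List (Fin n)) :
    Module.End ℝ (Fin n → ℝ) :=
  ((l.map (simpleRefl n d A)).reverse).prod

/-- `β` is a real root: `β = w (α i)` for some `w ∈ W` and some `i`. -/
def IsRoot (n : ℕ) (d : Fin n → ℤ) (A : Fin n → Fin n → ℤ) (β : Fin n → ℝ) : Prop :=
  ∃ (l : List (Fin n)) (i : Fin n), β = wprod n d A l (sroot n i)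

/-- `β` is a positive root: a real root all of whose coordinates are `≥ 0`. -/
def IsPosRoot (n : ℕ) (d : Fin n → ℤ) (A : Fin n → Fin n → ℤ) (β : Fin n → ℝ) : Prop :=
  IsRoot n d A β ∧ ∀ k, 0 ≤ β k

/-- `β` is a negative root: a real root all of whose coordinates are `≤ 0`. -/
def IsNegRoot (n : ℕ) (d : Fin n → ℤ) (A : Fin n → Fin n → ℤ) (β : Fin n → ℝ) : Prop :=
  IsRoot n d A β ∧ ∀ k, β k ≤ 0

/-- The reflection `t_β` along a root `β`: `t_β x = x - (β^∨, x) • β` where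
`β^∨ = d_β⁻¹ • β` and `d_β = (β, β)/2`. -/
def reflAlong (n : ℕ) (d : Fin n → ℤ) (A : Fin n → Fin n → ℤ) (β : Fin n → ℝ) :
    Module.End ℝ (Fin n → ℝ) :=
  LinearMap.id - (2 / formL n d A β β) • (formL n d A β).smulRight β

/-- `s i_r ⋯ s i_1 (α j)` (encoded by the list `l = [i_1, …, i_r]` and the index `j`)
is a positive expression: each partial application moves up in the root poset, i.e.
`s i_k ⋯ s i_1 (α j) - s i_{k-1} ⋯ s i_1 (α j) ∈ ℝ_{>0} • α i_k` for all `k`. -/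
def IsPosExpr (n : ℕ) (d : Fin n → ℤ) (A : Fin n → Fin n → ℤ) (j : Fin n)
    (l : List (Fin n)) : Prop :=
  ∀ k : Fin l.length, ∃ c : ℝ, 0 < c ∧
    wprod n d A (l.take (k.1 + 1)) (sroot n j) - wprod n d A (l.take k.1) (sroot n j)
      = c • sroot n (l.get k)

/-- The length `ℓ(w)`: the smallest `r` such that `w` is a product of `r` simple
reflections. -/
def len (n : ℕ) (d : Fin n → ℤ) (A : Fin n → Fin n → ℤ)
    (w : Module.End ℝ (Fin n → ℝ)) : ℕ :=
  sInf {r | ∃ l : List (Fin n), l.length = r ∧ wprod n d A l = w}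

/-- `R` is a rank two subsystem: `R = Φ ∩ L` for a two-dimensional subspace `L`
which is spanned by `R`. -/
def IsRankTwo (n : ℕ) (d : Fin n → ℤ) (A : Fin n → Fin n → ℤ)
    (R : Set (Fin n → ℝ)) : Prop :=
  ∃ L : Submodule ℝ (Fin n → ℝ), Module.finrank ℝ L = 2 ∧
    R = {γ | IsRoot n d A γ} ∩ (L : Set (Fin n → ℝ)) ∧ Submodule.span ℝ R = L

/-- `β` is a fundamental root of `R`: it is a positive root of `R` and there is a
second positive root `β'` of `R` such that every positive root of `R` is a
nonnegative combination of `β` and `β'`. -/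
def IsFundamentalIn (n : ℕ) (d : Fin n → ℤ) (A : Fin n → Fin n → ℤ)
    (R : Set (Fin n → ℝ)) (β : Fin n → ℝ) : Prop :=
  β ∈ R ∧ IsPosRoot n d A β ∧
    ∃ β' ∈ R, IsPosRoot n d A β' ∧ β' ≠ β ∧
      ∀ γ ∈ R, IsPosRoot n d A γ →
        ∃ c c' : ℝ, 0 ≤ c ∧ 0 ≤ c' ∧ γ = c • β + c' • β'

/-- The rank two subsystem `R` cuts `β^⊥`: `β ∈ R` but `β` is not a fundamental
root of `R`. -/
def CutsPerp (n : ℕ) (d : Fin n → ℤ) (A : Fin n → Fin n → ℤ)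
    (R : Set (Fin n → ℝ)) (β : Fin n → ℝ) : Prop :=
  IsRankTwo n d A R ∧ β ∈ R ∧ ¬ IsFundamentalIn n d A R β

/-! The dual space `V*` is also modelled as `Fin n → ℝ`, via the pairing
`⟨θ, x⟩ = ∑ i, θ i * x i`; thus `θ (α i) = θ i`.  The contragredient action of a
simple reflection `s i` on `θ ∈ V*` (characterized by `⟨s i • θ, s i x⟩ = ⟨θ, x⟩`,
using `s i⁻¹ = s i`) is the functional `x ↦ ⟨θ, s i x⟩`, whose coordinates are
computed on the standard basis. -/

/-- The contragredient (dual) action of the simple reflection `s i` on `V*`. -/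
def dualRefl (n : ℕ) (d : Fin n → ℤ) (A : Fin n → Fin n → ℤ) (i : Fin n)
    (θ : Fin n → ℝ) : Fin n → ℝ :=
  fun j => ∑ k, θ k * (simpleRefl n d A i (sroot n j)) k

/-- For `S ⊆ V`, the subspace `S^⊥ = {θ ∈ V* : ⟨θ, x⟩ = 0 for all x ∈ S}`. -/
def perpSet (n : ℕ) (S : Set (Fin n → ℝ)) : Set (Fin n → ℝ) :=
  {θ | ∀ x ∈ S, ∑ i, θ i * x i = 0}

/-- The hyperplane `β^⊥ ⊆ V*`. -/
def hyperplane (n : ℕ) (β : Fin n → ℝ) : Set (Fin n → ℝ) :=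
  {θ | ∑ i, θ i * β i = 0}

/-- The complement, inside `β^⊥`, of the union of the subspaces `R^⊥` over all rank
two subsystems `R` cutting `β^⊥`. -/
def shardComplement (n : ℕ) (d : Fin n → ℤ) (A : Fin n → Fin n → ℤ)
    (β : Fin n → ℝ) : Set (Fin n → ℝ) :=
  hyperplane n β \ ⋃ R ∈ {R | CutsPerp n d A R β}, perpSet n R

/-- `K` is a shard of `β^⊥`: the closure of a connected component of
`β^⊥ ∖ ⋃_{R cuts β^⊥} R^⊥`.  (Since this set lies in the closed hyperplane `β^⊥`,
closures taken in `β^⊥` and in `V*` agree.) -/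
def IsShard (n : ℕ) (d : Fin n → ℤ) (A : Fin n → Fin n → ℤ)
    (β : Fin n → ℝ) (K : Set (Fin n → ℝ)) : Prop :=
  ∃ θ ∈ shardComplement n d A β,
    K = closure (connectedComponentIn (shardComplement n d A β) θ)

/-- The operation `σ i^ε`: for `ε = true` (resp. `false`), intersect with the closed
halfspace `θ (α i) ≥ 0` (resp. `≤ 0`) and apply `s i`. -/
def sigmaOp (n : ℕ) (d : Fin n → ℤ) (A : Fin n → Fin n → ℤ) (i : Fin n) (ε : Bool)
    (K : Set (Fin n → ℝ)) : Set (Fin n → ℝ) :=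
  dualRefl n d A i '' (K ∩ {θ | if ε then 0 ≤ θ i else θ i ≤ 0})


/-! ### Helper lemmas -/

section Helpers

variable {n : ℕ} {d : Fin n → ℤ} {A : Fin n → Fin n → ℤ}

/-- the coefficient `⟨α_i^∨, x⟩` -/
def cf (A : Fin n → Fin n → ℤ) (i : Fin n) (x : Fin n → ℝ) : ℝ := ∑ k, (A i k : ℝ) * x k

lemma formL_apply (x y : Fin n → ℝ) :
    formL n d A x y = ∑ i, ∑ j, ((d i : ℝ) * (A i j : ℝ)) * (x i * y j) := by
  simp [formL, LinearMap.sum_apply]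

lemma formL_sroot (i : Fin n) (y : Fin n → ℝ) :
    formL n d A (sroot n i) y = (d i : ℝ) * cf A i y := by
  rw [formL_apply, Finset.sum_eq_single i]
  · simp [sroot, cf, Finset.mul_sum, mul_assoc]
  · intro b _ hb
    simp [sroot, Pi.single_eq_of_ne hb]
  · simp

lemma formL_symm (hsym : ∀ i j, d i * A i j = d j * A j i) (x y : Fin n → ℝ) :
    formL n d A x y = formL n d A y x := by
  rw [formL_apply, formL_apply, Finset.sum_comm]
  refine Finset.sum_congr rfl fun i _ => Finset.sum_congr rfl fun j _ => ?_
  have := hsym j i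
  have h : (d j : ℝ) * (A j i : ℝ) = d i * A i j := by exact_mod_cast this
  rw [h]; ring

lemma sR_apply (hd : ∀ i, 0 < d i) (i : Fin n) (x : Fin n → ℝ) :
    simpleRefl n d A i x = x - cf A i x • sroot n i := by
  have h : (d i : ℝ) ≠ 0 := by exact_mod_cast (hd i).ne'
  simp only [simpleRefl, LinearMap.sub_apply, LinearMap.id_apply, LinearMap.smul_apply,
    LinearMap.smulRight_apply, formL_sroot]
  rw [smul_smul, ← mul_assoc, inv_mul_cancel₀ h, one_mul]

lemma cf_sroot (i k : Fin n) : cf A i (sroot n k) = A i k := by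
  simp [cf, sroot, Pi.single_apply]

lemma cf_add (i : Fin n) (x y : Fin n → ℝ) : cf A i (x + y) = cf A i x + cf A i y := by
  simp [cf, mul_add, Finset.sum_add_distrib]

lemma cf_smul (i : Fin n) (c : ℝ) (x : Fin n → ℝ) : cf A i (c • x) = c * cf A i x := by
  simp only [cf, Finset.mul_sum, Pi.smul_apply, smul_eq_mul]
  exact Finset.sum_congr rfl fun k _ => by ring

lemma cf_sub (i : Fin n) (x y : Fin n → ℝ) : cf A i (x - y) = cf A i x - cf A i y := by
  simp [cf, mul_sub, Finset.sum_sub_distrib]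

lemma sR_invol (hd : ∀ i, 0 < d i) (hdiag : ∀ i, A i i = 2) (i : Fin n) (x : Fin n → ℝ) :
    simpleRefl n d A i (simpleRefl n d A i x) = x := by
  rw [sR_apply hd, sR_apply hd, cf_sub, cf_smul, cf_sroot, hdiag]
  push_cast
  module

lemma sR_sroot (hd : ∀ i, 0 < d i) (hdiag : ∀ i, A i i = 2) (i : Fin n) :
    simpleRefl n d A i (sroot n i) = - sroot n i := by
  rw [sR_apply hd, cf_sroot, hdiag]
  push_cast
  module

lemma sR_coord (hd : ∀ i, 0 < d i) {i k : Fin n} (h : k ≠ i) (x : Fin n → ℝ) :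
    simpleRefl n d A i x k = x k := by
  rw [sR_apply hd]; simp [sroot, h]

lemma formL_sR (hd : ∀ i, 0 < d i) (hsym : ∀ i j, d i * A i j = d j * A j i) (i : Fin n)
    (x y : Fin n → ℝ) :
    formL n d A (simpleRefl n d A i x) y = formL n d A x (simpleRefl n d A i y) := by
  rw [sR_apply hd, sR_apply hd]
  simp only [map_sub, map_smul, LinearMap.sub_apply, LinearMap.smul_apply, formL_sroot, smul_eq_mul]
  rw [formL_symm hsym x (sroot n i), formL_sroot]; ring

lemma wprod_nil : wprod n d A [] = 1 := by simp [wprod]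

lemma wprod_concat (l : List (Fin n)) (i : Fin n) (x : Fin n → ℝ) :
    wprod n d A (l ++ [i]) x = simpleRefl n d A i (wprod n d A l x) := by
  simp [wprod]

lemma wprod_cons (l : List (Fin n)) (i : Fin n) (x : Fin n → ℝ) :
    wprod n d A (i :: l) x = wprod n d A l (simpleRefl n d A i x) := by
  simp [wprod]

lemma isRoot_sroot (i : Fin n) : IsRoot n d A (sroot n i) := ⟨[], i, by simp [wprod]⟩

lemma isRoot_sR (i : Fin n) {x : Fin n → ℝ} (h : IsRoot n d A x) :
    IsRoot n d A (simpleRefl n d A i x) := by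
  obtain ⟨l, k, rfl⟩ := h
  exact ⟨l ++ [i], k, (wprod_concat _ _ _).symm⟩

lemma isRoot_induct {p : (Fin n → ℝ) → Prop} (h0 : ∀ i, p (sroot n i))
    (h1 : ∀ i x, IsRoot n d A x → p x → p (simpleRefl n d A i x)) {x : Fin n → ℝ}
    (h : IsRoot n d A x) : p x := by
  obtain ⟨l, k, rfl⟩ := h
  induction l using List.reverseRecOn with
  | nil => simpa [wprod] using h0 k
  | append_singleton l i ih =>
    rw [wprod_concat]
    exact h1 _ _ ⟨l, k, rfl⟩ ih

lemma isRoot_neg (hd : ∀ i, 0 < d i) (hdiag : ∀ i, A i i = 2) {x : Fin n → ℝ}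
    (h : IsRoot n d A x) : IsRoot n d A (-x) := by
  refine isRoot_induct (p := fun x => IsRoot n d A (-x)) (fun i => ?_) (fun i x _ hx => ?_) h
  · rw [← sR_sroot hd hdiag]; exact isRoot_sR _ (isRoot_sroot _)
  · rw [← map_neg]; exact isRoot_sR _ hx

lemma sroot_ne_zero (i : Fin n) : sroot n i ≠ 0 := by
  intro h
  have := congrFun h i
  simp [sroot] at this

lemma isRoot_ne_zero (hd : ∀ i, 0 < d i) (hdiag : ∀ i, A i i = 2) {x : Fin n → ℝ}
    (h : IsRoot n d A x) : x ≠ 0 := by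
  refine isRoot_induct (p := fun x => x ≠ 0) (fun i => sroot_ne_zero i) (fun i x _ hx => ?_) h
  intro h0
  apply hx
  rw [← sR_invol hd hdiag i x, h0, map_zero]

lemma refl_exists (hd : ∀ i, 0 < d i) (hdiag : ∀ i, A i i = 2)
    (hsym : ∀ i j, d i * A i j = d j * A j i) {g : Fin n → ℝ} (h : IsRoot n d A g) :
    ∃ (l : List (Fin n)) (c : ℝ), 0 < c ∧ c * formL n d A g g = 2 ∧
      ∀ x, wprod n d A l x = x - (c * formL n d A g x) • g := by
  refine isRoot_induct (p := fun g => ∃ (l : List (Fin n)) (c : ℝ), 0 < c ∧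
      c * formL n d A g g = 2 ∧
      ∀ x, wprod n d A l x = x - (c * formL n d A g x) • g) (fun i => ?_) (fun i x _ hx => ?_) h
  · have hi : (0 : ℝ) < d i := by exact_mod_cast hd i
    refine ⟨[i], (d i : ℝ)⁻¹, by positivity, ?_, fun x => ?_⟩
    · rw [formL_sroot, cf_sroot, hdiag]; field_simp; norm_num
    · rw [wprod_cons, wprod_nil, sR_apply hd, formL_sroot, ← mul_assoc, inv_mul_cancel₀ hi.ne',
        one_mul]; rfl
  · obtain ⟨l, c, hc, h2, hl⟩ := hx
    refine ⟨i :: (l ++ [i]), c, hc, ?_, fun y => ?_⟩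
    · rw [formL_sR hd hsym, sR_invol hd hdiag, h2]
    · rw [wprod_cons, wprod_concat, hl, map_sub, sR_invol hd hdiag, map_smul, formL_sR hd hsym]

lemma dihedral_arith (Q E : ℤ → ℤ → Prop) (a b p q H : ℤ) (ha : 0 ≤ a) (hb : 0 ≤ b)
    (hab : a = 0 ↔ b = 0) (hp : 0 < p) (hq : 0 < q)
    (hN : ∀ u v, Q u v → u + v ≤ H)
    (di : ∀ u v, Q u v → 0 < u + v → 0 < p - 2 * u + a * v →
      Q (p - u + a * v) v ∨ (p - 2 * u + a * v = 2 ∧ q + b * u - 2 * v = -b ∧ E u v))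
    (dk : ∀ u v, Q u v → 0 < u + v → 0 < q + b * u - 2 * v →
      Q u (q + b * u - v) ∨ (q + b * u - 2 * v = 2 ∧ p - 2 * u + a * v = -a))
    (ui : ∀ u v, Q u v → p - 2 * u + a * v < 0 → Q (p - u + a * v) v)
    (uk : ∀ u v, Q u v → q + b * u - 2 * v < 0 → Q u (q + b * u - v))
    (h0 : Q 0 q) (hsp : E 0 q → p = 1 → q = 1 → Q p 0) : Q p 0 := by
  by_cases h4 : 4 ≤ a * b
  · exfalso
    have key : ∀ m : ℕ, ∃ u v, Q u v ∧ (m : ℤ) < u + v ∧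
        ((0 < p - 2 * u + a * v ∧ q + b * u - 2 * v < 0 ∧
            0 < 2 * (p - 2 * u + a * v) + a * (q + b * u - 2 * v)) ∨
         (0 < q + b * u - 2 * v ∧ p - 2 * u + a * v < 0 ∧
            0 < 2 * (q + b * u - 2 * v) + b * (p - 2 * u + a * v))) := by
      intro m
      induction m with
      | zero =>
        refine ⟨0, q, h0, by simpa using hq, Or.inl ⟨?_, ?_, ?_⟩⟩ <;> nlinarith
      | succ m ih =>
        obtain ⟨u, v, hQ, hm, h | h⟩ := ih
        · obtain ⟨h1, h2, h3⟩ := h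
          set P := p - 2 * u + a * v with hP
          set R := q + b * u - 2 * v with hR
          have hbpos : 0 < b := by
            rcases hb.lt_or_eq with h | h
            · exact h
            · rw [← h] at h4; simp at h4
          have hx : b * (2 * P + a * R) > 0 := mul_pos hbpos h3
          have hy : (a * b - 4) * R ≤ 0 := mul_nonpos_of_nonneg_of_nonpos (by linarith) h2.le
          have hz : 0 < 2 * R + b * P := by nlinarith
          have hw : 0 < b * P := mul_pos hbpos h1
          rcases di u v hQ (by omega) h1 with h | ⟨h5, h6, _⟩
          · refine ⟨_, _, h, ?_, Or.inr ⟨?_, ?_, ?_⟩⟩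
            · push_cast; linarith
            · have : q + b * (p - u + a * v) - 2 * v = R + b * P := by rw [hP, hR]; ring
              rw [this]; linarith
            · linarith
            · have : 2 * (q + b * (p - u + a * v) - 2 * v) + b * (p - 2 * (p - u + a * v) + a * v)
                  = 2 * R + b * P := by rw [hP, hR]; ring
              rw [this]; exact hz
          · rw [hP, hR, h5, h6] at h3; exfalso; nlinarith
        · obtain ⟨h1, h2, h3⟩ := h
          set P := p - 2 * u + a * v with hP
          set R := q + b * u - 2 * v with hR
          have hapos : 0 < a := by
            rcases ha.lt_or_eq with h | h
            · exact h
            · rw [← h] at h4; simp at h4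
          have hx : a * (2 * R + b * P) > 0 := mul_pos hapos h3
          have hy : (a * b - 4) * P ≤ 0 := mul_nonpos_of_nonneg_of_nonpos (by linarith) h2.le
          have hz : 0 < 2 * P + a * R := by nlinarith
          have hw : 0 < a * R := mul_pos hapos h1
          rcases dk u v hQ (by omega) h1 with h | ⟨h5, h6⟩
          · refine ⟨_, _, h, ?_, Or.inl ⟨?_, ?_, ?_⟩⟩
            · push_cast; linarith
            · have : p - 2 * u + a * (q + b * u - v) = P + a * R := by rw [hP, hR]; ring
              rw [this]; linarith
            · linarith
            · have : 2 * (p - 2 * u + a * (q + b * u - v)) + a * (q + b * u - 2 * (q + b * u - v))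
                  = 2 * P + a * R := by rw [hP, hR]; ring
              rw [this]; exact hz
          · rw [hP, hR, h5, h6] at h3; exfalso; nlinarith
    obtain ⟨u, v, hQ, hm, -⟩ := key H.toNat
    have := hN u v hQ
    omega
  · push Not at h4
    have hcases : (a = 0 ∧ b = 0) ∨ (a = 1 ∧ b = 1) ∨ (a = 1 ∧ b = 2) ∨ (a = 2 ∧ b = 1) ∨
        (a = 1 ∧ b = 3) ∨ (a = 3 ∧ b = 1) := by
      rcases ha.lt_or_eq with h | h
      · have hb' : 0 < b := by
          rcases hb.lt_or_eq with h' | h'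
          · exact h'
          · have := hab.2 h'.symm; omega
        have : a < 4 := by nlinarith
        have : b < 4 := by nlinarith
        interval_cases a <;> interval_cases b <;> simp_all
      · left; exact ⟨h.symm, hab.1 h.symm⟩
    rcases hcases with ⟨rfl, rfl⟩ | ⟨rfl, rfl⟩ | ⟨rfl, rfl⟩ | ⟨rfl, rfl⟩ | ⟨rfl, rfl⟩ | ⟨rfl, rfl⟩
    · have h1 := (di _ _ h0 (by omega) (by omega)).resolve_right (by omega)
      have h2 := uk _ _ h1 (by omega)
      convert h2 using 1 <;> omega
    · rcases di _ _ h0 (by omega) (by omega) with h1 | ⟨h5, h6, hE⟩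
      · have h2 := (dk _ _ h1 (by omega) (by omega)).resolve_right (by omega)
        have h3 := ui _ _ h2 (by omega)
        have h4 := uk _ _ h3 (by omega)
        convert h4 using 1 <;> omega
      · exact hsp hE (by omega) (by omega)
    · have h1 := (di _ _ h0 (by omega) (by omega)).resolve_right (by omega)
      have h2 := (dk _ _ h1 (by omega) (by omega)).resolve_right (by omega)
      have h3 := (di _ _ h2 (by omega) (by omega)).resolve_right (by omega)
      have h4 := uk _ _ h3 (by omega)
      have h5 := ui _ _ h4 (by omega)
      have h6 := uk _ _ h5 (by omega)
      convert h6 using 1 <;> omega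
    · have h1 := (di _ _ h0 (by omega) (by omega)).resolve_right (by omega)
      have h2 := (dk _ _ h1 (by omega) (by omega)).resolve_right (by omega)
      have h3 := (di _ _ h2 (by omega) (by omega)).resolve_right (by omega)
      have h4 := uk _ _ h3 (by omega)
      have h5 := ui _ _ h4 (by omega)
      have h6 := uk _ _ h5 (by omega)
      convert h6 using 1 <;> omega
    · have h1 := (di _ _ h0 (by omega) (by omega)).resolve_right (by omega)
      have h2 := (dk _ _ h1 (by omega) (by omega)).resolve_right (by omega)
      have h3 := (di _ _ h2 (by omega) (by omega)).resolve_right (by omega)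
      have h4 := (dk _ _ h3 (by omega) (by omega)).resolve_right (by omega)
      have h5 := (di _ _ h4 (by omega) (by omega)).resolve_right (by omega)
      have h6 := uk _ _ h5 (by omega)
      have h7 := ui _ _ h6 (by omega)
      have h8 := uk _ _ h7 (by omega)
      have h9 := ui _ _ h8 (by omega)
      have h10 := uk _ _ h9 (by omega)
      convert h10 using 1 <;> omega
    · have h1 := (di _ _ h0 (by omega) (by omega)).resolve_right (by omega)
      have h2 := (dk _ _ h1 (by omega) (by omega)).resolve_right (by omega)
      have h3 := (di _ _ h2 (by omega) (by omega)).resolve_right (by omega)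
      have h4 := (dk _ _ h3 (by omega) (by omega)).resolve_right (by omega)
      have h5 := (di _ _ h4 (by omega) (by omega)).resolve_right (by omega)
      have h6 := uk _ _ h5 (by omega)
      have h7 := ui _ _ h6 (by omega)
      have h8 := uk _ _ h7 (by omega)
      have h9 := ui _ _ h8 (by omega)
      have h10 := uk _ _ h9 (by omega)
      convert h10 using 1 <;> omega

/-- integer version of `cf` -/
def cz (A : Fin n → Fin n → ℤ) (i : Fin n) (x : Fin n → ℤ) : ℤ := ∑ k, A i k * x k

/-- integer simple root -/
def ez (i : Fin n) : Fin n → ℤ := Pi.single i 1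

/-- vectors reachable from simple roots by going up -/
inductive PosZ (A : Fin n → Fin n → ℤ) : (Fin n → ℤ) → Prop
  | base (i : Fin n) : PosZ A (ez i)
  | up (i : Fin n) (x : Fin n → ℤ) : PosZ A x → cz A i x < 0 → PosZ A (x - cz A i x • ez i)

lemma cz_ez (i k : Fin n) : cz A i (ez k) = A i k := by
  simp [cz, ez, Pi.single_apply]

lemma cz_smul (i : Fin n) (c : ℤ) (x : Fin n → ℤ) : cz A i (c • x) = c * cz A i x := by
  simp only [cz, Finset.mul_sum, Pi.smul_apply, smul_eq_mul]
  exact Finset.sum_congr rfl fun k _ => by ring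

lemma cz_sub (i : Fin n) (x y : Fin n → ℤ) : cz A i (x - y) = cz A i x - cz A i y := by
  simp [cz, mul_sub, Finset.sum_sub_distrib]

lemma PosZ.nonneg {x : Fin n → ℤ} (h : PosZ A x) : ∀ k, 0 ≤ x k := by
  induction h with
  | base i => intro k; by_cases h : k = i <;> simp [ez, Pi.single_apply, h]
  | up i x _ hc ih =>
    intro k
    have := ih k
    by_cases h : k = i
    · subst h; simp [ez]; omega
    · simpa [ez, h] using this

lemma sum_ez (i : Fin n) : ∑ k, ez i k = 1 := by simp [ez, Pi.single_apply]

lemma PosZ.down (hdiag : ∀ i, A i i = 2) (hoff : ∀ i j, i ≠ j → A i j ≤ 0)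
    (hzero : ∀ i j, A i j = 0 ↔ A j i = 0) (N : ℕ) : ∀ (x : Fin n → ℤ), PosZ A x →
    ∑ k, x k < N → ∀ i, 0 < cz A i x → PosZ A (x - cz A i x • ez i) ∨ x = ez i := by
  induction N with
  | zero =>
    intro x hx h
    have := Finset.sum_nonneg (fun k (_ : k ∈ Finset.univ) => hx.nonneg k)
    simp at h; omega
  | succ N ih =>
    intro x hx hN i hi
    have hx' := hx
    rcases hx with k | ⟨k, y, hy, hc⟩
    · right
      rw [cz_ez] at hi
      by_contra hne
      have := hoff i k (fun h => hne (by rw [h]))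
      omega
    · left
      generalize hxdef : y - cz A k y • ez k = x at *
      have hckx : cz A k x = - cz A k y := by
        rw [← hxdef, cz_sub, cz_smul, cz_ez, hdiag]; ring
      have hyx : y = x - cz A k x • ez k := by
        rw [hckx, ← hxdef]; module
      by_cases hki : k = i
      · subst hki
        rw [← hyx]; exact hy
      have hsumX : ∀ u v : ℤ, ∑ m, (x - u • ez i - v • ez k) m = ∑ m, x m - u - v := by
        intro u v
        simp [Finset.sum_sub_distrib, ← Finset.mul_sum, sum_ez]
      have hci : ∀ u v : ℤ, cz A i (x - u • ez i - v • ez k)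
          = cz A i x - 2 * u + (-A i k) * v := by
        intro u v
        rw [cz_sub, cz_sub, cz_smul, cz_smul, cz_ez, cz_ez, hdiag]; ring
      have hck : ∀ u v : ℤ, cz A k (x - u • ez i - v • ez k)
          = cz A k x + (-A k i) * u - 2 * v := by
        intro u v
        rw [cz_sub, cz_sub, cz_smul, cz_smul, cz_ez, cz_ez, hdiag]; ring
      have hsi : ∀ u v : ℤ, (x - u • ez i - v • ez k) - cz A i (x - u • ez i - v • ez k) • ez i
          = x - (cz A i x - u + (-A i k) * v) • ez i - v • ez k := by
        intro u v
        rw [hci]; module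
      have hsk : ∀ u v : ℤ, (x - u • ez i - v • ez k) - cz A k (x - u • ez i - v • ez k) • ez k
          = x - u • ez i - (cz A k x + (-A k i) * u - v) • ez k := by
        intro u v
        rw [hck]; module
      have := dihedral_arith (fun u v => PosZ A (x - u • ez i - v • ez k))
        (fun u v => x - u • ez i - v • ez k = ez i) (-A i k) (-A k i) (cz A i x) (cz A k x)
        (∑ m, x m) (by have := hoff i k (Ne.symm hki); omega) (by have := hoff k i hki; omega)
        (by simpa using hzero i k) hi (by omega) ?_ ?_ ?_ ?_ ?_ ?_ ?_
      · simpa using this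
      · intro u v h
        have h1 := Finset.sum_nonneg (fun k (_ : k ∈ Finset.univ) => h.nonneg k)
        rw [hsumX] at h1; omega
      · intro u v h h1 h2
        rcases ih _ h (by rw [hsumX]; push_cast at hN; omega) i (by rw [hci]; exact h2) with h3 | h3
        · left; rw [hsi] at h3; exact h3
        · right
          refine ⟨?_, ?_, h3⟩
          · rw [← hci, h3, cz_ez, hdiag]
          · rw [← hck, h3, cz_ez]; ring
      · intro u v h h1 h2
        rcases ih _ h (by rw [hsumX]; push_cast at hN; omega) k (by rw [hck]; exact h2) with h3 | h3
        · left; rw [hsk] at h3; exact h3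
        · right
          refine ⟨?_, ?_⟩
          · rw [← hck, h3, cz_ez, hdiag]
          · rw [← hci, h3, cz_ez]; ring
      · intro u v h h1
        have := PosZ.up i _ h (by rw [hci]; exact h1)
        rw [hsi] at this; exact this
      · intro u v h h1
        have := PosZ.up k _ h (by rw [hck]; exact h1)
        rw [hsk] at this; exact this
      · simp only [zero_smul, sub_zero]; rw [← hyx]; exact hy
      · intro h1 h2 h3
        simp only [h2, h3] at h1 ⊢
        have : x - (1 : ℤ) • ez i - (0 : ℤ) • ez k = ez k := by
          have e : x = ez i + ez k := by
            rw [← h1]; module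
          rw [e]; module
        rw [this]; exact PosZ.base k

lemma root_int (hd : ∀ i, 0 < d i) (hdiag : ∀ i, A i i = 2) (hoff : ∀ i j, i ≠ j → A i j ≤ 0)
    (hsym : ∀ i j, d i * A i j = d j * A j i) {x : Fin n → ℝ} (h : IsRoot n d A x) :
    ∃ z : Fin n → ℤ, PosZ A z ∧ ((x = fun k => (z k : ℝ)) ∨ x = fun k => (-z k : ℝ)) := by
  have hzero : ∀ i j, A i j = 0 ↔ A j i = 0 := by
    intro i j
    have h := hsym i j
    have h1 := hd i
    have h2 := hd j
    constructor <;> intro h0 <;> rw [h0] at h <;> simp at h <;> omega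
  have hcast : ∀ (i : Fin n) (z : Fin n → ℤ), simpleRefl n d A i (fun k => (z k : ℝ))
      = fun k => (((z - cz A i z • ez i) k : ℤ) : ℝ) := by
    intro i z
    rw [sR_apply hd]
    ext k
    by_cases hk : k = i
    · subst hk; simp [cf, cz, sroot, ez]
    · simp [sroot, ez, hk]
  have hneg : ∀ (z : Fin n → ℤ), (fun k => (-z k : ℝ)) = - (fun k => (z k : ℝ)) := by
    intro z; rfl
  refine isRoot_induct (p := fun x => ∃ z : Fin n → ℤ, PosZ A z ∧
    ((x = fun k => (z k : ℝ)) ∨ x = fun k => (-z k : ℝ))) (fun i => ?_) (fun i x _ hx => ?_) h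
  · refine ⟨ez i, PosZ.base i, Or.inl ?_⟩
    ext k
    by_cases hk : k = i
    · subst hk; simp [sroot, ez]
    · simp [sroot, ez, hk]
  · obtain ⟨z, hz, hxz⟩ := hx
    have key : PosZ A (z - cz A i z • ez i) ∨ z = ez i := by
      rcases lt_trichotomy (cz A i z) 0 with h | h | h
      · exact Or.inl (PosZ.up i z hz h)
      · left; rw [h]; simpa using hz
      · obtain ⟨N, hN⟩ : ∃ N : ℕ, ∑ k, z k < N := ⟨(∑ k, z k).toNat + 1, by push_cast; omega⟩
        exact PosZ.down hdiag hoff hzero N z hz hN i h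
    rcases key with h1 | h1
    · refine ⟨_, h1, ?_⟩
      rcases hxz with rfl | rfl
      · left; exact hcast i z
      · right; rw [hneg, hneg, map_neg, hcast]
    · refine ⟨z, hz, ?_⟩
      have : simpleRefl n d A i (fun k => (z k : ℝ)) = fun k => (-z k : ℝ) := by
        rw [hcast, h1, cz_ez, hdiag]
        ext k
        simp; ring
      rcases hxz with rfl | rfl
      · right; exact this
      · left; rw [hneg, map_neg, this, hneg, neg_neg]

lemma root_dich (hd : ∀ i, 0 < d i) (hdiag : ∀ i, A i i = 2) (hoff : ∀ i j, i ≠ j → A i j ≤ 0)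
    (hsym : ∀ i j, d i * A i j = d j * A j i) {x : Fin n → ℝ} (h : IsRoot n d A x) :
    (∀ k, 0 ≤ x k) ∨ (∀ k, x k ≤ 0) := by
  obtain ⟨z, hz, rfl | rfl⟩ := root_int hd hdiag hoff hsym h
  · left; intro k
    have := hz.nonneg k
    have : (0 : ℝ) ≤ z k := by exact_mod_cast this
    simpa using this
  · right; intro k
    have := hz.nonneg k
    have : (0 : ℝ) ≤ z k := by exact_mod_cast this
    simpa using this

lemma pos_sR (hd : ∀ i, 0 < d i) (hdiag : ∀ i, A i i = 2) (hoff : ∀ i j, i ≠ j → A i j ≤ 0)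
    (hsym : ∀ i j, d i * A i j = d j * A j i) {x : Fin n → ℝ} (h : IsPosRoot n d A x)
    (i : Fin n) (hne : ∀ c : ℝ, x ≠ c • sroot n i) :
    IsPosRoot n d A (simpleRefl n d A i x) := by
  refine ⟨isRoot_sR i h.1, ?_⟩
  rcases root_dich hd hdiag hoff hsym (isRoot_sR i h.1) with h1 | h1
  · exact h1
  · exfalso
    apply hne (x i)
    ext k
    by_cases hk : k = i
    · subst hk; simp [sroot]
    · have h2 := h1 k
      rw [sR_coord hd hk] at h2
      have := h.2 k
      simp [sroot, hk]; linarith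

lemma inv_finite (hd : ∀ i, 0 < d i) (hdiag : ∀ i, A i i = 2) (hoff : ∀ i j, i ≠ j → A i j ≤ 0)
    (hsym : ∀ i j, d i * A i j = d j * A j i) (l : List (Fin n)) :
    ∃ F : Set (Fin n → ℝ), F.Finite ∧ ∀ x, IsPosRoot n d A x → (∀ k, wprod n d A l x k ≤ 0) →
      ∃ v ∈ F, ∃ c : ℝ, x = c • v := by
  induction l with
  | nil =>
    refine ⟨∅, Set.finite_empty, fun x hx h => ?_⟩
    exfalso
    apply isRoot_ne_zero hd hdiag hx.1
    ext k
    exact le_antisymm (by simpa [wprod] using h k) (hx.2 k)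
  | cons i l ih =>
    obtain ⟨F, hF, h⟩ := ih
    refine ⟨insert (sroot n i) (simpleRefl n d A i '' F), (hF.image _).insert _, fun x hx hx' => ?_⟩
    by_cases hne : ∀ c : ℝ, x ≠ c • sroot n i
    · obtain ⟨v, hv, c, hc⟩ := h _ (pos_sR hd hdiag hoff hsym hx i hne)
        (by simpa only [wprod_cons] using hx')
      refine ⟨_, Set.mem_insert_of_mem _ ⟨v, hv, rfl⟩, c, ?_⟩
      rw [← map_smul, ← hc, sR_invol hd hdiag]
    · push Not at hne
      exact ⟨_, Set.mem_insert _ _, hne⟩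

lemma two_dim {L : Submodule ℝ (Fin n → ℝ)} (h2 : Module.finrank ℝ L = 2) {a g : Fin n → ℝ}
    (ha : a ∈ L) (hg : g ∈ L) (ha0 : a ≠ 0) (hga : ∀ c : ℝ, g ≠ c • a) {x : Fin n → ℝ}
    (hx : x ∈ L) : ∃ s t : ℝ, x = s • a + t • g := by
  have hli : LinearIndependent ℝ ![a, g] := by
    rw [LinearIndependent.pair_iff' ha0]
    intro c h; exact hga c h.symm
  have hsp : Submodule.span ℝ (Set.range ![a, g]) = L := by
    apply Submodule.eq_of_le_of_finrank_eq
    · rw [Submodule.span_le]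
      rintro _ ⟨i, rfl⟩
      fin_cases i
      · exact ha
      · exact hg
    · rw [finrank_span_eq_card hli, h2]; simp
  rw [← hsp] at hx
  simp only [Matrix.range_cons, Matrix.range_empty, Set.union_empty, Set.singleton_union] at hx
  obtain ⟨s, t, h⟩ := Submodule.mem_span_pair.1 hx
  exact ⟨s, t, h.symm⟩

lemma sroot_not_cut (hd : ∀ i, 0 < d i) (hdiag : ∀ i, A i i = 2)
    (hoff : ∀ i j, i ≠ j → A i j ≤ 0)
    (hsym : ∀ i j, d i * A i j = d j * A j i) (j : Fin n) (R : Set (Fin n → ℝ)) :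
    ¬ CutsPerp n d A R (sroot n j) := by
  rintro ⟨⟨L, hL2, hRL, hsp⟩, hjR, hnf⟩
  apply hnf
  have hjpos : IsPosRoot n d A (sroot n j) := by
    refine ⟨isRoot_sroot j, fun k => ?_⟩
    by_cases hk : k = j
    · subst hk; simp [sroot]
    · simp [sroot, hk]
  have hjL : sroot n j ∈ L := by rw [hRL] at hjR; exact hjR.2
  -- a root in `R` not proportional to `α_j`
  obtain ⟨g1, hg1R, hg1⟩ : ∃ g ∈ R, ∀ c : ℝ, g ≠ c • sroot n j := by
    by_contra hcon
    push Not at hcon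
    have : L ≤ Submodule.span ℝ {sroot n j} := by
      rw [← hsp, Submodule.span_le]
      intro x hx
      obtain ⟨c, rfl⟩ := hcon x hx
      exact Submodule.smul_mem _ _ (Submodule.mem_span_singleton_self _)
    have h1 := Submodule.finrank_mono this
    rw [hL2, finrank_span_singleton (sroot_ne_zero j)] at h1
    omega
  have hg1L : g1 ∈ L := by rw [hRL] at hg1R; exact hg1R.2
  have hg1r : IsRoot n d A g1 := by rw [hRL] at hg1R; exact hg1R.1
  -- make it positive
  obtain ⟨g2, hg2L, hg2p, hg2⟩ : ∃ g ∈ L, IsPosRoot n d A g ∧ ∀ c : ℝ, g ≠ c • sroot n j := by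
    rcases root_dich hd hdiag hoff hsym hg1r with h | h
    · exact ⟨g1, hg1L, ⟨hg1r, h⟩, hg1⟩
    · refine ⟨-g1, L.neg_mem hg1L, ⟨isRoot_neg hd hdiag hg1r, fun k => by simpa using h k⟩, ?_⟩
      intro c hc
      apply hg1 (-c)
      rw [neg_smul, ← hc, neg_neg]
  -- make it have nonpositive coefficient
  obtain ⟨g, hgL, hgp, hg, hgc⟩ : ∃ g ∈ L, IsPosRoot n d A g ∧ (∀ c : ℝ, g ≠ c • sroot n j) ∧
      cf A j g ≤ 0 := by
    by_cases h : cf A j g2 ≤ 0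
    · exact ⟨g2, hg2L, hg2p, hg2, h⟩
    · refine ⟨simpleRefl n d A j g2, ?_, pos_sR hd hdiag hoff hsym hg2p j hg2, ?_, ?_⟩
      · rw [sR_apply hd]; exact L.sub_mem hg2L (L.smul_mem _ hjL)
      · intro c hc
        apply hg2 (-c)
        rw [← sR_invol hd hdiag j g2, hc, map_smul, sR_sroot hd hdiag, smul_neg, neg_smul]
      · rw [sR_apply hd, cf_sub, cf_smul, cf_sroot, hdiag]; push_cast; linarith
  obtain ⟨k, hkj, hgk⟩ : ∃ k, k ≠ j ∧ 0 < g k := by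
    by_contra hcon
    push Not at hcon
    apply hg (g j)
    ext k
    by_cases hk : k = j
    · subst hk; simp [sroot]
    · have := hcon k hk
      have := hgp.2 k
      simp [sroot, hk]; linarith
  have hjk : sroot n j k = 0 := by simp [sroot, hkj]
  have hjj : sroot n j j = 1 := by simp [sroot]
  have hdec : ∀ x ∈ L, ∃ s t : ℝ, x = s • sroot n j + t • g := fun x hx =>
    two_dim hL2 hjL hgL (sroot_ne_zero j) hg hx
  obtain ⟨l, c, hc, hc2, hl⟩ := refl_exists hd hdiag hsym hgp.1
  obtain ⟨F, hF, hFx⟩ := inv_finite hd hdiag hoff hsym l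
  let ρ : (Fin n → ℝ) → ℝ := fun x => x j / x k
  let M : Set (Fin n → ℝ) := {x | x ∈ L ∧ IsPosRoot n d A x ∧ 0 < x k ∧ ρ x ≤ ρ g}
  have hgM : g ∈ M := ⟨hgL, hgp, hgk, le_refl _⟩
  have hMfin : (ρ '' M).Finite := by
    apply ((hF.image ρ).insert (ρ g)).subset
    rintro _ ⟨x, ⟨hxL, hxp, hxk, hxρ⟩, rfl⟩
    obtain ⟨s, t, hst⟩ := hdec x hxL
    have hxk' : x k = t * g k := by rw [hst]; simp [hjk]
    have hxj' : x j = s + t * g j := by rw [hst]; simp [hjj]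
    have ht : 0 < t := by
      rw [hxk'] at hxk
      exact pos_of_mul_pos_left hxk hgk.le
    have hs : s ≤ 0 := by
      simp only [ρ] at hxρ
      rw [hxk', hxj', div_le_div_iff₀ (by positivity) hgk] at hxρ
      by_contra hs
      push Not at hs
      have : 0 < s * g k := mul_pos hs hgk
      nlinarith
    right
    obtain ⟨v, hv, e, hxe⟩ := hFx x hxp (by
      intro m
      have hB : formL n d A g (sroot n j) ≤ 0 := by
        rw [formL_symm hsym, formL_sroot]
        have : (0 : ℝ) < d j := by exact_mod_cast hd j
        exact mul_nonpos_of_nonneg_of_nonpos this.le hgc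
      have e1 : wprod n d A l x = s • sroot n j + (-t - s * (c * formL n d A g (sroot n j))) • g := by
        rw [hl, hst, map_add, map_smul, map_smul, smul_eq_mul, smul_eq_mul]
        have : c * (s * formL n d A g (sroot n j) + t * formL n d A g g)
          = s * (c * formL n d A g (sroot n j)) + t * 2 := by rw [← hc2]; ring
        rw [this]; module
      rw [e1]
      have h1 : s * sroot n j m ≤ 0 := mul_nonpos_of_nonpos_of_nonneg hs (hjpos.2 m)
      have h2 : c * formL n d A g (sroot n j) ≤ 0 := mul_nonpos_of_nonneg_of_nonpos hc.le hB
      have h3 : 0 ≤ s * (c * formL n d A g (sroot n j)) := mul_nonneg_of_nonpos_of_nonpos hs h2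
      have h4 : (-t - s * (c * formL n d A g (sroot n j))) * g m ≤ 0 :=
        mul_nonpos_of_nonpos_of_nonneg (by linarith) (hgp.2 m)
      simp only [Pi.add_apply, Pi.smul_apply, smul_eq_mul]
      linarith)
    refine ⟨v, hv, ?_⟩
    have he : e ≠ 0 := by
      rintro rfl
      rw [hxe] at hxk; simp at hxk
    simp only [ρ]
    rw [hxe]
    simp only [Pi.smul_apply, smul_eq_mul]
    rw [mul_div_mul_left _ _ he]
  obtain ⟨_, ⟨b, hbM, rfl⟩, hmin⟩ := hMfin.isCompact.exists_isLeast ⟨_, g, hgM, rfl⟩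
  obtain ⟨hbL, hbp, hbk, hbρ⟩ := hbM
  refine ⟨hjR, hjpos, b, ?_, hbp, ?_, ?_⟩
  · rw [hRL]; exact ⟨hbp.1, hbL⟩
  · rintro rfl
    rw [hjk] at hbk; exact lt_irrefl _ hbk
  · intro x hxR hxp
    have hxL : x ∈ L := by rw [hRL] at hxR; exact hxR.2
    have hρ : ∀ (_ : 0 < x k), ρ b ≤ ρ x := by
      intro hxk
      by_cases h : ρ x ≤ ρ g
      · exact hmin ⟨x, ⟨hxL, hxp, hxk, h⟩, rfl⟩
      · linarith
    have hge : x k * b j ≤ x j * b k := by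
      rcases (hxp.2 k).lt_or_eq with h | h
      · have := hρ h
        simp only [ρ] at this
        rw [div_le_div_iff₀ hbk h] at this
        linarith
      · rw [← h, zero_mul]; exact mul_nonneg (hxp.2 j) hbk.le
    obtain ⟨s, t, hst⟩ := hdec x hxL
    obtain ⟨s', t', hst'⟩ := hdec b hbL
    have e1 : x k = t * g k := by rw [hst]; simp [hjk]
    have e2 : x j = s + t * g j := by rw [hst]; simp [hjj]
    have e3 : b k = t' * g k := by rw [hst']; simp [hjk]
    have e4 : b j = s' + t' * g j := by rw [hst']; simp [hjj]
    have ht' : 0 < t' := by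
      rw [e3] at hbk
      exact pos_of_mul_pos_left hbk hgk.le
    have ht : 0 ≤ t := by
      have := hxp.2 k
      rw [e1] at this
      exact nonneg_of_mul_nonneg_left this hgk
    rw [e1, e2, e3, e4] at hge
    have hge' : t * s' ≤ s * t' := by
      have : (t * s') * g k ≤ (s * t') * g k := by nlinarith
      exact le_of_mul_le_mul_right this hgk
    refine ⟨s - t / t' * s', t / t', ?_, by positivity, ?_⟩
    · have : t / t' * s' = (t * s') / t' := by ring
      rw [this, sub_nonneg, div_le_iff₀ ht']; exact hge'
    · rw [hst, hst', smul_add, smul_smul, smul_smul, div_mul_cancel₀ _ ht'.ne']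
      module

lemma sroot_dot (θ : Fin n → ℝ) (i : Fin n) : ∑ k, θ k * sroot n i k = θ i := by
  simp [sroot, Pi.single_apply]

lemma dual_pair (i : Fin n) (θ x : Fin n → ℝ) :
    ∑ k, dualRefl n d A i θ k * x k = ∑ k, θ k * simpleRefl n d A i x k := by
  have hx : x = ∑ j, x j • sroot n j := by
    ext k; simp [sroot, Pi.single_apply]
  conv_rhs => rw [hx, map_sum]
  simp only [dualRefl, map_smul, Finset.sum_apply, Pi.smul_apply, smul_eq_mul, Finset.mul_sum,
    Finset.sum_mul]
  rw [Finset.sum_comm]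
  refine Finset.sum_congr rfl fun a _ => Finset.sum_congr rfl fun b _ => by ring

lemma dual_coord (hd : ∀ i, 0 < d i) (hdiag : ∀ i, A i i = 2) (i : Fin n) (θ : Fin n → ℝ) :
    dualRefl n d A i θ i = - θ i := by
  rw [← sroot_dot (dualRefl n d A i θ) i, dual_pair, sR_sroot hd hdiag]
  simp [sroot_dot]

lemma dual_invol (hd : ∀ i, 0 < d i) (hdiag : ∀ i, A i i = 2) (i : Fin n) (θ : Fin n → ℝ) :
    dualRefl n d A i (dualRefl n d A i θ) = θ := by
  ext j
  rw [← sroot_dot (dualRefl n d A i (dualRefl n d A i θ)) j, dual_pair, dual_pair, sR_invol hd hdiag, sroot_dot]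

lemma mem_dual_image (hd : ∀ i, 0 < d i) (hdiag : ∀ i, A i i = 2) (i : Fin n) (θ : Fin n → ℝ)
    (S : Set (Fin n → ℝ)) : θ ∈ dualRefl n d A i '' S ↔ dualRefl n d A i θ ∈ S := by
  constructor
  · rintro ⟨φ, hφ, rfl⟩; rwa [dual_invol hd hdiag]
  · intro h; exact ⟨_, h, dual_invol hd hdiag i θ⟩

lemma image_image (hd : ∀ i, 0 < d i) (hdiag : ∀ i, A i i = 2) (i : Fin n)
    (R : Set (Fin n → ℝ)) : simpleRefl n d A i '' (simpleRefl n d A i '' R) = R := by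
  rw [Set.image_image]; simp [sR_invol hd hdiag]

lemma rankTwo_image (hd : ∀ i, 0 < d i) (hdiag : ∀ i, A i i = 2) (i : Fin n)
    {R : Set (Fin n → ℝ)} (h : IsRankTwo n d A R) : IsRankTwo n d A (simpleRefl n d A i '' R) := by
  obtain ⟨L, hL, hR, hsp⟩ := h
  have hinj : Function.Injective (simpleRefl n d A i) :=
    Function.LeftInverse.injective (sR_invol hd hdiag i)
  refine ⟨L.map (simpleRefl n d A i), ?_, ?_, ?_⟩
  · rw [← hL]; exact (LinearEquiv.finrank_eq (Submodule.equivMapOfInjective _ hinj L)).symm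
  · ext x
    constructor
    · rintro ⟨y, hy, rfl⟩
      rw [hR] at hy
      exact ⟨isRoot_sR i hy.1, Submodule.mem_map_of_mem hy.2⟩
    · rintro ⟨hx, y, hy, rfl⟩
      refine ⟨y, ?_, rfl⟩
      rw [hR]
      refine ⟨?_, hy⟩
      have := isRoot_sR i hx
      rwa [sR_invol hd hdiag] at this
  · rw [Submodule.span_image, hsp]

lemma fund_image (hd : ∀ i, 0 < d i) (hdiag : ∀ i, A i i = 2)
    (hoff : ∀ i j, i ≠ j → A i j ≤ 0)
    (hsym : ∀ i j, d i * A i j = d j * A j i) (i : Fin n)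
    {R : Set (Fin n → ℝ)} (hR : ∀ x ∈ R, ∀ c : ℝ, x ≠ c • sroot n i) {x : Fin n → ℝ}
    (h : IsFundamentalIn n d A R x) :
    IsFundamentalIn n d A (simpleRefl n d A i '' R) (simpleRefl n d A i x) := by
  obtain ⟨hxR, hxp, y, hyR, hyp, hyx, hall⟩ := h
  refine ⟨⟨x, hxR, rfl⟩, pos_sR hd hdiag hoff hsym hxp i (hR x hxR), _, ⟨y, hyR, rfl⟩,
    pos_sR hd hdiag hoff hsym hyp i (hR y hyR), ?_, ?_⟩
  · intro h
    exact hyx (Function.LeftInverse.injective (sR_invol hd hdiag i) h)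
  · rintro _ ⟨g, hg, rfl⟩ hgp
    have : IsPosRoot n d A g := by
      have := pos_sR hd hdiag hoff hsym hgp i (by
        intro c hc
        apply hR g hg (-c)
        rw [← sR_invol hd hdiag i g, hc, map_smul, sR_sroot hd hdiag, smul_neg, neg_smul])
      rwa [sR_invol hd hdiag] at this
    obtain ⟨c, c', h1, h2, h3⟩ := hall g hg this
    refine ⟨c, c', h1, h2, ?_⟩
    rw [h3, map_add, map_smul, map_smul]

lemma rankTwo_noprop {R : Set (Fin n → ℝ)} (h : IsRankTwo n d A R) {i : Fin n}
    (hi : sroot n i ∉ R) (hd : ∀ i, 0 < d i) (hdiag : ∀ i, A i i = 2) :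
    ∀ x ∈ R, ∀ c : ℝ, x ≠ c • sroot n i := by
  rintro x hx c rfl
  obtain ⟨L, hL, hR, hsp⟩ := h
  rw [hR] at hx hi
  apply hi
  refine ⟨isRoot_sroot i, ?_⟩
  have hc : c ≠ 0 := by
    rintro rfl
    exact isRoot_ne_zero hd hdiag hx.1 (zero_smul _ _)
  have := L.smul_mem c⁻¹ hx.2
  rwa [smul_smul, inv_mul_cancel₀ hc, one_smul] at this

lemma cuts_image (hd : ∀ i, 0 < d i) (hdiag : ∀ i, A i i = 2)
    (hoff : ∀ i j, i ≠ j → A i j ≤ 0)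
    (hsym : ∀ i j, d i * A i j = d j * A j i) (i : Fin n)
    {R : Set (Fin n → ℝ)} (hi : sroot n i ∉ R) {x : Fin n → ℝ}
    (h : CutsPerp n d A R x) :
    CutsPerp n d A (simpleRefl n d A i '' R) (simpleRefl n d A i x) := by
  obtain ⟨h2, hx, hnf⟩ := h
  refine ⟨rankTwo_image hd hdiag i h2, ⟨x, hx, rfl⟩, fun hf => hnf ?_⟩
  have hnp := rankTwo_noprop h2 hi hd hdiag
  have := fund_image hd hdiag hoff hsym i (R := simpleRefl n d A i '' R) (by
    rintro _ ⟨y, hy, rfl⟩ c hc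
    apply hnp y hy (-c)
    rw [← sR_invol hd hdiag i y, hc, map_smul, sR_sroot hd hdiag, smul_neg, neg_smul]) hf
  rwa [image_image hd hdiag, sR_invol hd hdiag] at this

lemma perp_image (i : Fin n) (R : Set (Fin n → ℝ)) (θ : Fin n → ℝ) :
    θ ∈ perpSet n (simpleRefl n d A i '' R) ↔ dualRefl n d A i θ ∈ perpSet n R := by
  simp only [perpSet, Set.mem_ofPred_eq, Set.forall_mem_image, dual_pair]

lemma cut_new (hd : ∀ i, 0 < d i) {g b : Fin n → ℝ} (hg : IsPosRoot n d A g)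
    (hb : IsPosRoot n d A b) {i : Fin n} {c : ℝ} (hc : 0 < c) (hbg : b = g + c • sroot n i)
    (hne : ∀ c : ℝ, b ≠ c • sroot n i) :
    ∃ R, CutsPerp n d A R b ∧ ∀ x ∈ R, ∃ s t : ℝ, x = s • sroot n i + t • b := by
  have hli : LinearIndependent ℝ ![sroot n i, b] := by
    rw [LinearIndependent.pair_iff' (sroot_ne_zero i)]
    intro c h; exact hne c h.symm
  have hipos : IsPosRoot n d A (sroot n i) := by
    refine ⟨isRoot_sroot i, fun k => ?_⟩
    by_cases hk : k = i
    · subst hk; simp [sroot]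
    · simp [sroot, hk]
  let L := Submodule.span ℝ (Set.range ![sroot n i, b])
  have hpair : L = Submodule.span ℝ {sroot n i, b} := by
    simp [L, Matrix.range_cons, Matrix.range_empty, Set.pair_comm]
  have hiL : sroot n i ∈ L := Submodule.subset_span ⟨0, rfl⟩
  have hbL : b ∈ L := Submodule.subset_span ⟨1, rfl⟩
  have hgL : g ∈ L := by
    have : g = b - c • sroot n i := by rw [hbg]; module
    rw [this]; exact L.sub_mem hbL (L.smul_mem _ hiL)
  refine ⟨{γ | IsRoot n d A γ} ∩ (L : Set (Fin n → ℝ)), ⟨⟨L, ?_, rfl, ?_⟩, ⟨hb.1, hbL⟩, ?_⟩, ?_⟩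
  · rw [finrank_span_eq_card hli]; simp
  · apply le_antisymm
    · rw [Submodule.span_le]; exact Set.inter_subset_right
    · refine hpair.le.trans ?_
      rw [Submodule.span_le]
      rintro x (rfl | rfl)
      · exact Submodule.subset_span ⟨isRoot_sroot i, hiL⟩
      · exact Submodule.subset_span ⟨hb.1, hbL⟩
  · rintro ⟨-, -, b', hb'R, hb'p, -, hall⟩
    obtain ⟨c1, c1', h1, h1', e1⟩ := hall _ ⟨isRoot_sroot i, hiL⟩ hipos
    obtain ⟨c2, c2', h2, h2', e2⟩ := hall _ ⟨hg.1, hgL⟩ hg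
    have hprop : ∀ m : ℝ, sroot n i ≠ m • b := by
      intro m hm
      have hm0 : m ≠ 0 := by
        rintro rfl
        rw [zero_smul] at hm; exact sroot_ne_zero i hm
      apply hne m⁻¹
      rw [hm, smul_smul, inv_mul_cancel₀ hm0, one_smul]
    have key : (c2' + c * c1') • b' = (1 - c2 - c * c1) • b := by
      have : b = (c2 • b + c2' • b') + c • (c1 • b + c1' • b') := by rw [← e1, ← e2]; exact hbg
      have h3 : (c2' + c * c1') • b' = (c2 • b + c2' • b') + c • (c1 • b + c1' • b')
        - (c2 + c * c1) • b := by module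
      rw [h3, ← this]; module
    have hcc : 0 ≤ c * c1' := by positivity
    rcases (show 0 ≤ c2' + c * c1' by positivity).lt_or_eq with h | h
    · have : b' = ((c2' + c * c1')⁻¹ * (1 - c2 - c * c1)) • b := by
        rw [← smul_smul, ← key, smul_smul, inv_mul_cancel₀ h.ne', one_smul]
      apply hprop (c1 + c1' * ((c2' + c * c1')⁻¹ * (1 - c2 - c * c1)))
      rw [add_smul, ← smul_smul, ← this]; exact e1
    · have : c1' = 0 := by
        have : c * c1' = 0 := by linarith
        exact (mul_eq_zero.1 this).resolve_left hc.ne'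
      rw [this, zero_smul, add_zero] at e1
      exact hprop _ e1
  · rintro x ⟨-, hx⟩
    rw [hpair] at hx
    obtain ⟨s, t, h⟩ := Submodule.mem_span_pair.1 hx
    exact ⟨s, t, h.symm⟩

lemma mem_sc (b θ : Fin n → ℝ) : θ ∈ shardComplement n d A b ↔
    ∑ k, θ k * b k = 0 ∧ ∀ R, CutsPerp n d A R b → θ ∉ perpSet n R := by
  simp [shardComplement, hyperplane]

lemma sc_step (hd : ∀ i, 0 < d i) (hdiag : ∀ i, A i i = 2)
    (hoff : ∀ i j, i ≠ j → A i j ≤ 0)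
    (hsym : ∀ i j, d i * A i j = d j * A j i) {g b : Fin n → ℝ} (hg : IsPosRoot n d A g)
    (hb : IsPosRoot n d A b) {i : Fin n} {c : ℝ} (hc : 0 < c) (hbg : b = g + c • sroot n i)
    (hne : ∀ c : ℝ, b ≠ c • sroot n i) (hs : b = simpleRefl n d A i g) (θ : Fin n → ℝ) :
    θ ∈ shardComplement n d A b ↔ dualRefl n d A i θ ∈ shardComplement n d A g ∧ θ i ≠ 0 := by
  have hs' : g = simpleRefl n d A i b := by rw [hs, sR_invol hd hdiag]
  rw [mem_sc, mem_sc, dual_pair, ← hs]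
  constructor
  · rintro ⟨h0, h⟩
    have hθ : θ i ≠ 0 := by
      intro hi
      obtain ⟨R, hR, hx⟩ := cut_new hd hg hb hc hbg hne
      apply h R hR
      intro x hxR
      obtain ⟨s, t, rfl⟩ := hx x hxR
      have : ∑ k, θ k * (s • sroot n i + t • b) k
          = s * ∑ k, θ k * sroot n i k + t * ∑ k, θ k * b k := by
        rw [Finset.mul_sum, Finset.mul_sum, ← Finset.sum_add_distrib]
        refine Finset.sum_congr rfl fun k _ => ?_
        simp; ring
      rw [this, sroot_dot, hi, h0]; simp
    refine ⟨⟨h0, fun R hR hp => ?_⟩, hθ⟩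
    by_cases hi : sroot n i ∈ R
    · have := hp _ hi
      rw [sroot_dot, dual_coord hd hdiag] at this
      exact hθ (by linarith)
    · have := cuts_image hd hdiag hoff hsym i hi hR
      rw [← hs] at this
      exact h _ this ((perp_image i R θ).2 hp)
  · rintro ⟨⟨h0, h⟩, hθ⟩
    refine ⟨h0, fun R hR hp => ?_⟩
    by_cases hi : sroot n i ∈ R
    · have := hp _ hi
      rw [sroot_dot] at this
      exact hθ this
    · have := cuts_image hd hdiag hoff hsym i hi hR
      rw [← hs'] at this
      refine h _ this ((perp_image i R _).2 ?_)
      rwa [dual_invol hd hdiag]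

/-- sign condition -/
def sgn (e : Bool) (r : ℝ) : Prop := if e then 0 ≤ r else r ≤ 0

lemma shard_desc (hd : ∀ i, 0 < d i) (hdiag : ∀ i, A i i = 2)
    (hoff : ∀ i j, i ≠ j → A i j ≤ 0)
    (hsym : ∀ i j, d i * A i j = d j * A j i) (j : Fin n) (l : List (Fin n))
    (hl : IsPosExpr n d A j l) :
    IsPosRoot n d A (wprod n d A l (sroot n j)) ∧
    ∃ vs : List (Fin n → ℝ), vs.length = l.length ∧
      (∀ v ∈ vs, ∀ c : ℝ, v ≠ c • wprod n d A l (sroot n j)) ∧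
      (∀ θ, θ ∈ shardComplement n d A (wprod n d A l (sroot n j)) ↔
        ∑ k, θ k * wprod n d A l (sroot n j) k = 0 ∧ ∀ v ∈ vs, ∑ k, θ k * v k ≠ 0) ∧
      (∀ ε : List Bool, ε.length = l.length → ∀ θ,
        θ ∈ (l.zip ε).foldl (fun K p => sigmaOp n d A p.1 p.2 K) (hyperplane n (sroot n j)) ↔
        ∑ k, θ k * wprod n d A l (sroot n j) k = 0 ∧
          ∀ p ∈ vs.zip ε, sgn p.2 (∑ k, θ k * p.1 k)) := by
  induction l using List.reverseRecOn with
  | nil =>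
    have hw : wprod n d A [] (sroot n j) = sroot n j := by simp [wprod]
    rw [hw]
    refine ⟨⟨isRoot_sroot j, fun k => ?_⟩, [], rfl, by simp, ?_, ?_⟩
    · by_cases hk : k = j
      · subst hk; simp [sroot]
      · simp [sroot, hk]
    · intro θ
      rw [mem_sc]
      simp [sroot_not_cut hd hdiag hoff hsym j]
    · intro ε _ θ
      simp [hyperplane]
  | append_singleton l i ih =>
    have hl' : IsPosExpr n d A j l := by
      intro k
      have := hl ⟨k.1, by simp⟩
      obtain ⟨c, hc, h⟩ := this
      refine ⟨c, hc, ?_⟩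
      have e1 : (l ++ [i]).take (k.1 + 1) = l.take (k.1 + 1) :=
        List.take_append_of_le_length (by omega)
      have e2 : (l ++ [i]).take k.1 = l.take k.1 :=
        List.take_append_of_le_length (by omega)
      simp only [e1, e2] at h
      rw [h]
      simp
    obtain ⟨hg, vs, hvs, hnp, hsc, hK⟩ := ih hl'
    obtain ⟨c, hc, hcb⟩ := hl ⟨l.length, by simp⟩
    have e1 : (l ++ [i]).take (l.length + 1) = l ++ [i] := by
      apply List.take_of_length_le; simp
    have e2 : (l ++ [i]).take l.length = l := by simp
    simp only [e1, e2] at hcb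
    have e3 : (l ++ [i]).get ⟨l.length, by simp⟩ = i := by simp
    rw [e3] at hcb
    have hs : wprod n d A (l ++ [i]) (sroot n j) = simpleRefl n d A i (wprod n d A l (sroot n j)) :=
      wprod_concat _ _ _
    generalize wprod n d A (l ++ [i]) (sroot n j) = b at *
    generalize wprod n d A l (sroot n j) = g at *
    have hbg : b = g + c • sroot n i := by rw [← hcb]; module
    have hgne : ∀ m : ℝ, g ≠ m • sroot n i := by
      intro m hm
      have h1 : b i = - m := by
        rw [hs, hm, map_smul, sR_sroot hd hdiag]; simp [sroot]
      have h2 : g i = m := by rw [hm]; simp [sroot]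
      have h3 : b i = g i + c := by rw [hbg]; simp [sroot]
      have h4 := hg.2 i
      linarith
    have hbne : ∀ m : ℝ, b ≠ m • sroot n i := by
      intro m hm
      apply hgne (m - c)
      have : g = b - c • sroot n i := by rw [hbg]; module
      rw [this, hm]; module
    have hb : IsPosRoot n d A b := by
      rw [hs]; exact pos_sR hd hdiag hoff hsym hg i hgne
    refine ⟨hb, vs.map (simpleRefl n d A i) ++ [- sroot n i], by simp [hvs], ?_, ?_, ?_⟩
    · intro v hv m hm
      rw [List.mem_append, List.mem_map, List.mem_singleton] at hv
      rcases hv with ⟨v, hv, rfl⟩ | rfl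
      · apply hnp v hv m
        rw [← sR_invol hd hdiag i v, hm, hs, map_smul, sR_invol hd hdiag]
      · have hm0 : m ≠ 0 := by
          rintro rfl
          rw [zero_smul, neg_eq_zero] at hm; exact sroot_ne_zero i hm
        apply hbne (-m⁻¹)
        rw [neg_smul, ← smul_neg, hm, smul_smul, inv_mul_cancel₀ hm0, one_smul]
    · intro θ
      rw [sc_step hd hdiag hoff hsym hg hb hc hbg hbne hs, hsc, dual_pair, ← hs]
      have : ∑ k, θ k * (-sroot n i) k = - θ i := by
        rw [← sroot_dot θ i, ← Finset.sum_neg_distrib]; simp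
      simp only [List.forall_mem_append, List.forall_mem_singleton, List.forall_mem_map, this,
        dual_pair, neg_ne_zero, and_assoc]
    · intro ε hε θ
      obtain ⟨ε', e, rfl⟩ : ∃ ε' e, ε = ε' ++ [e] := by
        have : ε ≠ [] := by rintro rfl; simp at hε
        exact ⟨ε.dropLast, ε.getLast this, (List.dropLast_append_getLast this).symm⟩
      have hε' : ε'.length = l.length := by simpa using hε
      rw [List.zip_append hε'.symm, List.foldl_append, List.zip_append (by simp [hvs, hε'])]
      simp only [List.zip_cons_cons, List.zip_nil_right, List.foldl_cons, List.foldl_nil]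
      rw [sigmaOp, mem_dual_image hd hdiag, Set.mem_inter_iff, hK ε' hε', dual_pair, ← hs]
      have : ∑ k, θ k * (-sroot n i) k = dualRefl n d A i θ i := by
        rw [dual_coord hd hdiag, ← sroot_dot θ i, ← Finset.sum_neg_distrib]; simp
      rw [List.forall_mem_append, List.forall_mem_singleton, List.zip_map_left,
        List.forall_mem_map, this, and_assoc]
      simp only [dual_pair, Prod.map_fst, Prod.map_snd, id, sgn, Set.mem_ofPred_eq]

lemma dot_add (x y v : Fin n → ℝ) :
    ∑ k, (x + y) k * v k = ∑ k, x k * v k + ∑ k, y k * v k := by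
  simp [add_mul, Finset.sum_add_distrib]

lemma dot_smul (t : ℝ) (x v : Fin n → ℝ) :
    ∑ k, (t • x) k * v k = t * ∑ k, x k * v k := by
  simp [Finset.mul_sum, mul_assoc]

lemma dot_cont (v : Fin n → ℝ) : Continuous fun x : Fin n → ℝ => ∑ k, x k * v k := by
  fun_prop

/-- strict sign condition -/
def sgs (e : Bool) (r : ℝ) : Prop := if e then 0 < r else r < 0

lemma sgs_sgn {e : Bool} {r : ℝ} (h : sgs e r) : sgn e r := by
  cases e <;> simp [sgs, sgn] at * <;> linarith

lemma sgs_ne {e : Bool} {r : ℝ} (h : sgs e r) : r ≠ 0 := by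
  cases e <;> simp [sgs] at h
  · exact h.ne
  · exact h.ne'

lemma sgn_ne {e : Bool} {r : ℝ} (h : sgn e r) (h0 : r ≠ 0) : sgs e r := by
  cases e <;> simp [sgn, sgs] at *
  · exact lt_of_le_of_ne h h0
  · exact lt_of_le_of_ne h (Ne.symm h0)

lemma sgn_add {e : Bool} {r s : ℝ} (h : sgn e r) (h' : sgn e s) : sgn e (r + s) := by
  cases e <;> simp [sgn] at * <;> linarith

lemma sgs_add {e : Bool} {r s : ℝ} (h : sgn e r) (h' : sgs e s) : sgs e (r + s) := by
  cases e <;> simp [sgn, sgs] at * <;> linarith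

lemma sgs_mul {e : Bool} {t r : ℝ} (ht : 0 < t) (h : sgs e r) : sgs e (t * r) := by
  cases e <;> simp [sgs] at *
  · exact mul_neg_of_pos_of_neg ht h
  · positivity

lemma sgn_mul {e : Bool} {t r : ℝ} (ht : 0 ≤ t) (h : sgn e r) : sgn e (t * r) := by
  cases e <;> simp [sgn] at *
  · exact mul_nonpos_of_nonneg_of_nonpos ht h
  · positivity

lemma sgn_closed (e : Bool) : IsClosed {r | sgn e r} := by
  cases e
  · simp only [sgn, Bool.false_eq_true, if_false]; exact isClosed_le continuous_id continuous_const
  · simp only [sgn, if_true]; exact isClosed_le continuous_const continuous_id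

lemma sgs_open (e : Bool) : IsOpen {r | sgs e r} := by
  cases e
  · simp only [sgs, Bool.false_eq_true, if_false]; exact isOpen_lt continuous_id continuous_const
  · simp only [sgs, if_true]; exact isOpen_lt continuous_const continuous_id

/-- closed cone -/
def Kc (b : Fin n → ℝ) (ps : List ((Fin n → ℝ) × Bool)) : Set (Fin n → ℝ) :=
  {θ | ∑ k, θ k * b k = 0 ∧ ∀ p ∈ ps, sgn p.2 (∑ k, θ k * p.1 k)}

/-- open cone -/
def Ko (b : Fin n → ℝ) (ps : List ((Fin n → ℝ) × Bool)) : Set (Fin n → ℝ) :=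
  {θ | ∑ k, θ k * b k = 0 ∧ ∀ p ∈ ps, sgs p.2 (∑ k, θ k * p.1 k)}

/-- arrangement complement -/
def Cm (b : Fin n → ℝ) (vs : List (Fin n → ℝ)) : Set (Fin n → ℝ) :=
  {θ | ∑ k, θ k * b k = 0 ∧ ∀ v ∈ vs, ∑ k, θ k * v k ≠ 0}

lemma Ko_sub_Kc (b : Fin n → ℝ) (ps) : Ko b ps ⊆ Kc b ps :=
  fun _ h => ⟨h.1, fun p hp => sgs_sgn (h.2 p hp)⟩

lemma Ko_convex (b : Fin n → ℝ) (ps) : Convex ℝ (Ko b ps) := by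
  rw [convex_iff_forall_pos]
  intro x hx y hy s t hs ht _
  refine ⟨?_, fun p hp => ?_⟩
  · rw [dot_add, dot_smul, dot_smul, hx.1, hy.1]; simp
  · rw [dot_add, dot_smul, dot_smul]
    exact sgs_add (sgs_sgn (sgs_mul hs (hx.2 p hp))) (sgs_mul ht (hy.2 p hp))

lemma Kc_closed (b : Fin n → ℝ) (ps) : IsClosed (Kc b ps) := by
  have : Kc b ps = {θ | ∑ k, θ k * b k = 0} ∩ ⋂ p ∈ ps, {θ | sgn p.2 (∑ k, θ k * p.1 k)} := by
    ext θ; simp [Kc]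
  rw [this]
  refine (isClosed_eq (dot_cont b) continuous_const).inter ?_
  exact isClosed_iInter fun p => isClosed_iInter fun _ =>
    (sgn_closed p.2).preimage (dot_cont p.1)

lemma Ko_closure {b : Fin n → ℝ} {ps} {θ0 : Fin n → ℝ} (h0 : θ0 ∈ Ko b ps) :
    closure (Ko b ps) = Kc b ps := by
  apply subset_antisymm
  · exact closure_minimal (Ko_sub_Kc b ps) (Kc_closed b ps)
  · intro x hx
    have ht : Filter.Tendsto (fun t : ℝ => x + t • θ0) (nhdsWithin 0 (Set.Ioi 0)) (nhds x) := by
      have : Continuous fun t : ℝ => x + t • θ0 := by fun_prop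
      have h := this.tendsto 0
      simp only [zero_smul, add_zero] at h
      exact h.mono_left nhdsWithin_le_nhds
    refine mem_closure_of_tendsto ht ?_
    filter_upwards [self_mem_nhdsWithin] with t ht
    refine ⟨?_, fun p hp => ?_⟩
    · rw [dot_add, dot_smul, hx.1, h0.1]; simp
    · rw [dot_add, dot_smul]
      exact sgs_add (hx.2 p hp) (sgs_mul ht (h0.2 p hp))

lemma zip_snd {vs : List (Fin n → ℝ)} {ε : List Bool} (h : ε.length = vs.length) {v : Fin n → ℝ}
    (hv : v ∈ vs) : ∃ e, (v, e) ∈ vs.zip ε := by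
  have : (vs.zip ε).map Prod.fst = vs := List.map_fst_zip h.ge
  rw [← this, List.mem_map] at hv
  obtain ⟨⟨w, e⟩, h1, rfl⟩ := hv
  exact ⟨e, h1⟩

lemma component_eq {b : Fin n → ℝ} {vs : List (Fin n → ℝ)} {ε : List Bool}
    (hε : ε.length = vs.length) {θ0 : Fin n → ℝ} (h0 : θ0 ∈ Ko b (vs.zip ε)) :
    connectedComponentIn (Cm b vs) θ0 = Ko b (vs.zip ε) := by
  have hsub : Ko b (vs.zip ε) ⊆ Cm b vs := by
    intro θ hθ
    refine ⟨hθ.1, fun v hv => ?_⟩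
    obtain ⟨e, he⟩ := zip_snd hε hv
    exact sgs_ne (hθ.2 _ he)
  apply subset_antisymm
  · intro θ hθ
    have hθC := connectedComponentIn_subset _ _ hθ
    refine ⟨hθC.1, ?_⟩
    rintro ⟨v, e⟩ hp
    have hv : v ∈ vs := (List.of_mem_zip hp).1
    have hpre : IsPreconnected (connectedComponentIn (Cm b vs) θ0) :=
      isPreconnected_connectedComponentIn
    have him := (hpre.image _ (dot_cont v).continuousOn).ordConnected
    have hm0 := Set.mem_image_of_mem (fun x : Fin n → ℝ => ∑ k, x k * v k)
      (mem_connectedComponentIn (hsub h0))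
    have hm1 := Set.mem_image_of_mem (fun x : Fin n → ℝ => ∑ k, x k * v k) hθ
    have hz : (0 : ℝ) ∉ (fun x : Fin n → ℝ => ∑ k, x k * v k) ''
        connectedComponentIn (Cm b vs) θ0 := by
      rintro ⟨y, hy, hy0⟩
      exact (connectedComponentIn_subset _ _ hy).2 v hv hy0
    have hs := h0.2 _ hp
    cases e
    · simp only [sgs, Bool.false_eq_true, if_false] at hs ⊢
      by_contra hcon
      push Not at hcon
      exact hz (him.out hm0 hm1 ⟨hs.le, hcon⟩)
    · simp only [sgs, if_true] at hs ⊢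
      by_contra hcon
      push Not at hcon
      exact hz (him.out hm1 hm0 ⟨hcon, hs.le⟩)
  · exact (Ko_convex b _).isPreconnected.subset_connectedComponentIn h0 hsub

/-- pairing with `b` as a functional -/
def fnl (b : Fin n → ℝ) : (Fin n → ℝ) →ₗ[ℝ] ℝ where
  toFun x := ∑ k, x k * b k
  map_add' x y := dot_add x y b
  map_smul' t x := dot_smul t x b

lemma finrank_ker_fnl {b : Fin n → ℝ} (hb : b ≠ 0) :
    Module.finrank ℝ (LinearMap.ker (fnl b)) = n - 1 := by
  have hne : fnl b ≠ 0 := by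
    intro h
    apply hb
    ext k
    have := LinearMap.congr_fun h (Pi.single k 1)
    simpa [fnl, Pi.single_apply] using this
  have h1 := LinearMap.finrank_range_add_finrank_ker (fnl b)
  have h2 : LinearMap.range (fnl b) = ⊤ :=
    LinearMap.range_eq_top.2 (LinearMap.surjective hne)
  rw [h2, finrank_top, Module.finrank_self, Module.finrank_fin_fun] at h1
  omega

lemma span_Kc_le (b : Fin n → ℝ) (ps) : Submodule.span ℝ (Kc b ps) ≤ LinearMap.ker (fnl b) := by
  rw [Submodule.span_le]
  intro x hx
  exact hx.1

lemma span_of_Ko {b : Fin n → ℝ} {ps} {θ0 : Fin n → ℝ} (h0 : θ0 ∈ Ko b ps) :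
    Submodule.span ℝ (Kc b ps) = LinearMap.ker (fnl b) := by
  apply le_antisymm (span_Kc_le b ps)
  intro y hy
  have hy0 : ∑ k, y k * b k = 0 := hy
  have hev : ∀ᶠ t : ℝ in nhds 0, ∀ p ∈ ps, sgs p.2 (∑ k, (θ0 + t • y) k * p.1 k) := by
    have hfin : {p | p ∈ ps}.Finite := List.finite_toSet ps
    refine (Filter.eventually_all_finite hfin).2 fun p hp => ?_
    have hc : Continuous fun t : ℝ => ∑ k, (θ0 + t • y) k * p.1 k :=
      (dot_cont p.1).comp (by fun_prop)
    refine hc.continuousAt.eventually_mem ((sgs_open p.2).mem_nhds ?_)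
    simpa using h0.2 p hp
  have hev' : ∀ᶠ t : ℝ in nhdsWithin 0 (Set.Ioi 0),
      ∀ p ∈ ps, sgs p.2 (∑ k, (θ0 + t • y) k * p.1 k) := hev.filter_mono nhdsWithin_le_nhds
  obtain ⟨t, h1, ht⟩ := (hev'.and self_mem_nhdsWithin).exists
  have ht : 0 < t := ht
  have hm : θ0 + t • y ∈ Kc b ps := by
    refine Ko_sub_Kc b ps ⟨?_, h1⟩
    rw [dot_add, dot_smul, h0.1, hy0]; simp
  have : y = t⁻¹ • ((θ0 + t • y) - θ0) := by
    rw [add_sub_cancel_left, smul_smul, inv_mul_cancel₀ ht.ne', one_smul]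
  rw [this]
  exact Submodule.smul_mem _ _ (Submodule.sub_mem _ (Submodule.subset_span hm)
    (Submodule.subset_span (Ko_sub_Kc b ps h0)))

lemma prop_of_ker {b v : Fin n → ℝ} (hb : b ≠ 0)
    (h : ∀ θ : Fin n → ℝ, ∑ k, θ k * b k = 0 → ∑ k, θ k * v k = 0) : ∃ c : ℝ, v = c • b := by
  obtain ⟨k, hk⟩ : ∃ k, b k ≠ 0 := by
    by_contra hcon
    push Not at hcon
    exact hb (funext hcon)
  have hk : b k ≠ 0 := hk
  refine ⟨v k / b k, ?_⟩
  ext m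
  have hθ : ∀ w : Fin n → ℝ, ∑ j, (b k • sroot n m + (-b m) • sroot n k) j * w j
      = b k * w m - b m * w k := by
    intro w
    rw [dot_add, dot_smul, dot_smul]
    have : ∀ i, ∑ j, sroot n i j * w j = w i := by
      intro i; simp [sroot, Pi.single_apply]
    rw [this, this]; ring
  have := h (b k • sroot n m + (-b m) • sroot n k) (by rw [hθ]; ring)
  rw [hθ] at this
  simp only [Pi.smul_apply, smul_eq_mul]
  field_simp
  linarith

lemma Ko_of_span {b : Fin n → ℝ} (hb : b ≠ 0) {ps : List ((Fin n → ℝ) × Bool)}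
    (hps : ∀ p ∈ ps, ∀ c : ℝ, p.1 ≠ c • b)
    (hsp : Submodule.span ℝ (Kc b ps) = LinearMap.ker (fnl b)) : ∃ θ0, θ0 ∈ Ko b ps := by
  have hx : ∀ p ∈ ps, ∃ x ∈ Kc b ps, ∑ k, x k * p.1 k ≠ 0 := by
    intro p hp
    by_contra hcon
    push Not at hcon
    obtain ⟨c, hc⟩ := prop_of_ker (v := p.1) hb (by
      intro θ hθ
      have hθ' : θ ∈ LinearMap.ker (fnl b) := hθ
      rw [← hsp] at hθ'
      have : Submodule.span ℝ (Kc b ps) ≤ LinearMap.ker (fnl p.1) := by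
        rw [Submodule.span_le]
        intro x hx
        exact hcon x hx
      exact this hθ')
    exact hps p hp c hc
  have key : ∀ qs : List ((Fin n → ℝ) × Bool), (∀ q ∈ qs, q ∈ ps) →
      ∃ θ ∈ Kc b ps, ∀ q ∈ qs, sgs q.2 (∑ k, θ k * q.1 k) := by
    intro qs
    induction qs with
    | nil => 
      intro _
      refine ⟨0, ⟨by simp, fun p hp => ?_⟩, by simp⟩
      simp [sgn]
    | cons q qs ih =>
      intro hq
      obtain ⟨θ, hθ, h1⟩ := ih fun r hr => hq r (List.mem_cons_of_mem _ hr)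
      have hqp := hq q List.mem_cons_self
      obtain ⟨x, hxK, hx0⟩ := hx q hqp
      refine ⟨θ + x, ⟨?_, fun p hp => ?_⟩, ?_⟩
      · rw [dot_add, hθ.1, hxK.1, add_zero]
      · rw [dot_add]; exact sgn_add (hθ.2 p hp) (hxK.2 p hp)
      · intro r hr
        rcases List.mem_cons.1 hr with rfl | hr'
        · rw [dot_add]
          exact sgs_add (hθ.2 _ hqp) (sgn_ne (hxK.2 _ hqp) hx0)
        · rw [dot_add, add_comm]
          exact sgs_add (hxK.2 r (hq r hr)) (h1 r hr')
  obtain ⟨θ, hθ, h1⟩ := key ps fun _ h => h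
  exact ⟨θ, hθ.1, h1⟩

end Helpers

/-- for a positive root `β` with positive expression
`β = s i_r ⋯ s i_1 (α j)`, the shards of `β^⊥` are exactly those sets of the form
`σ i_r^{ε_r} ⋯ σ i_1^{ε_1} (α j ^⊥)` (over all sign choices `ε`) whose linear span
has dimension `n - 1`. -/
theorem stmt10 (n : ℕ) (hn : 1 ≤ n) (d : Fin n → ℤ) (A : Fin n → Fin n → ℤ)
    (hd : ∀ i, 0 < d i) (hdiag : ∀ i, A i i = 2)
    (hoff : ∀ i j, i ≠ j → A i j ≤ 0)
    (hsym : ∀ i j, d i * A i j = d j * A j i)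
    (j : Fin n) (l : List (Fin n)) (hl : IsPosExpr n d A j l)
    (β : Fin n → ℝ) (hβ : β = wprod n d A l (sroot n j)) :
    {K | IsShard n d A β K}
      = {K | (∃ ε : List Bool, ε.length = l.length ∧
            K = (l.zip ε).foldl (fun K p => sigmaOp n d A p.1 p.2 K)
                  (hyperplane n (sroot n j)))
          ∧ Module.finrank ℝ (Submodule.span ℝ K) = n - 1} := by
  obtain ⟨hpos, vs, hvs, hnp, hsc, hK⟩ := shard_desc hd hdiag hoff hsym j l hl
  rw [← hβ] at hpos hnp hsc hK
  have hβ0 : β ≠ 0 := isRoot_ne_zero hd hdiag hpos.1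
  have hSC : shardComplement n d A β = Cm β vs := Set.ext hsc
  have hKc : ∀ ε : List Bool, ε.length = l.length →
      (l.zip ε).foldl (fun K p => sigmaOp n d A p.1 p.2 K) (hyperplane n (sroot n j))
        = Kc β (vs.zip ε) := fun ε hε => Set.ext (hK ε hε)
  ext K
  constructor
  · rintro ⟨θ, hθ, rfl⟩
    rw [hSC] at hθ ⊢
    let ε : List Bool := vs.map fun v => decide (0 < ∑ k, θ k * v k)
    have hε : ε.length = vs.length := by simp [ε]
    have h0 : θ ∈ Ko β (vs.zip ε) := by
      refine ⟨hθ.1, ?_⟩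
      intro p hp
      have hz : vs.zip ε = vs.map fun v => (v, decide (0 < ∑ k, θ k * v k)) := by
        simp only [ε]
        rw [← List.map_prod_left_eq_zip]
      rw [hz, List.mem_map] at hp
      obtain ⟨v, hv, rfl⟩ := hp
      have hne := hθ.2 v hv
      simp only [sgs, decide_eq_true_eq]
      split_ifs with h
      · exact h
      · exact lt_of_le_of_ne (not_lt.1 h) hne
    rw [component_eq hε h0, Ko_closure h0]
    refine ⟨⟨ε, hε.trans hvs, (hKc ε (hε.trans hvs)).symm⟩, ?_⟩
    rw [span_of_Ko h0, finrank_ker_fnl hβ0]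
  · rintro ⟨⟨ε, hε, rfl⟩, hfr⟩
    rw [hKc ε hε] at hfr ⊢
    have hsp : Submodule.span ℝ (Kc β (vs.zip ε)) = LinearMap.ker (fnl β) := by
      apply Submodule.eq_of_le_of_finrank_eq (span_Kc_le _ _)
      rw [hfr, finrank_ker_fnl hβ0]
    obtain ⟨θ0, h0⟩ := Ko_of_span hβ0 (fun p hp => hnp p.1 (List.of_mem_zip hp).1) hsp
    have hcomp := component_eq (hε.trans hvs.symm) h0
    refine ⟨θ0, ?_, ?_⟩
    · rw [hSC]
      have : θ0 ∈ connectedComponentIn (Cm β vs) θ0 := by rw [hcomp]; exact h0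
      exact connectedComponentIn_subset _ _ this
    · rw [hSC, hcomp, Ko_closure h0]

end
end

section
/- Let T_1 and T_2 be torsion classes in Mod(R). Then T_1 ⊆ T_2 if and only if every brick belonging to T_1 belongs to T_2. In particular, T_1 = T_2 if and only if T_1 and T_2 contain exactly the same bricks. -/
/-!
Setup: `k` is a field and `R` an associative unital `k`-algebra.  `Mod(R)` is
modelled by the bundled structure `FDMod k R` of left `R`-modules that are
finite-dimensional over `k` (with compatible `k`-action).
-/

/-- An object of `Mod(R)`: a left `R`-module which is finite dimensional as a
`k`-vector space. -/
structure FDMod (k R : Type) [Field k] [Ring R] [Algebra k R] : Type 1 where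
  carrier : Type
  [acg : AddCommGroup carrier]
  [modk : Module k carrier]
  [modR : Module R carrier]
  [tower : IsScalarTower k R carrier]
  [fd : FiniteDimensional k carrier]

attribute [instance] FDMod.acg FDMod.modk FDMod.modR FDMod.tower FDMod.fd

variable (k R : Type) [Field k] [Ring R] [Algebra k R]

/-- A torsion class: a class of modules in `Mod(R)`, closed under isomorphism,
containing the zero module, and closed under quotients and extensions. -/
def IsTorsionClass (T : Set (FDMod k R)) : Prop :=
  (∀ M N : FDMod k R, M ∈ T → Nonempty (M.carrier ≃ₗ[R] N.carrier) → N ∈ T) ∧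
  (∀ M : FDMod k R, Subsingleton M.carrier → M ∈ T) ∧
  (∀ M N : FDMod k R, M ∈ T →
    ∀ f : M.carrier →ₗ[R] N.carrier, Function.Surjective f → N ∈ T) ∧
  (∀ M₁ M₂ M₃ : FDMod k R, M₁ ∈ T → M₃ ∈ T →
    ∀ (f : M₁.carrier →ₗ[R] M₂.carrier) (g : M₂.carrier →ₗ[R] M₃.carrier),
      Function.Injective f → Function.Surjective g →
      LinearMap.range f = LinearMap.ker g → M₂ ∈ T)

/-- A torsion-free class: a class of modules in `Mod(R)`, closed under isomorphism,
containing the zero module, and closed under submodules and extensions. -/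
def IsTorsionFreeClass (F : Set (FDMod k R)) : Prop :=
  (∀ M N : FDMod k R, M ∈ F → Nonempty (M.carrier ≃ₗ[R] N.carrier) → N ∈ F) ∧
  (∀ M : FDMod k R, Subsingleton M.carrier → M ∈ F) ∧
  (∀ M N : FDMod k R, M ∈ F →
    ∀ f : N.carrier →ₗ[R] M.carrier, Function.Injective f → N ∈ F) ∧
  (∀ M₁ M₂ M₃ : FDMod k R, M₁ ∈ F → M₃ ∈ F →
    ∀ (f : M₁.carrier →ₗ[R] M₂.carrier) (g : M₂.carrier →ₗ[R] M₃.carrier),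
      Function.Injective f → Function.Surjective g →
      LinearMap.range f = LinearMap.ker g → M₂ ∈ F)

/-- A brick: a module whose endomorphism ring is a division ring, i.e. a nonzero
module all of whose nonzero endomorphisms are bijective. -/
def IsBrick (M : FDMod k R) : Prop :=
  Nontrivial M.carrier ∧
    ∀ f : M.carrier →ₗ[R] M.carrier, f ≠ 0 → Function.Bijective f

theorem torsion_aux (T₁ T₂ : Set (FDMod k R))
    (h₁ : IsTorsionClass k R T₁) (h₂ : IsTorsionClass k R T₂)
    (hb : ∀ M : FDMod k R, IsBrick k R M → M ∈ T₁ → M ∈ T₂) (n : ℕ) :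
    ∀ M : FDMod k R, Module.finrank k M.carrier = n → M ∈ T₁ → M ∈ T₂ := by
  induction n using Nat.strong_induction_on with
  | _ n ih =>
  intro M hn hM
  by_cases hM0 : Subsingleton M.carrier
  · exact h₂.2.1 M hM0
  rw [not_subsingleton_iff_nontrivial] at hM0
  by_cases hB : IsBrick k R M
  · exact hb M hB hM
  have key : ∃ f : M.carrier →ₗ[R] M.carrier, f ≠ 0 ∧ ¬ Function.Bijective f := by
    by_contra hc
    push Not at hc
    exact hB ⟨hM0, hc⟩
  obtain ⟨f, hf0, hfb⟩ := key
  have hinj : ¬ Function.Injective f := fun hi =>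
    hfb ⟨hi, LinearMap.injective_iff_surjective (f := f.restrictScalars k) |>.1 hi⟩
  -- every proper quotient lies in both classes
  have hq : ∀ (N : FDMod k R) (g : M.carrier →ₗ[R] N.carrier), Function.Surjective g →
      ¬ Function.Injective g → N ∈ T₂ := by
    intro N g hg hgi
    refine ih _ ?_ N rfl (h₁.2.2.1 M N hM g hg)
    rw [← hn]
    have h1 := LinearMap.finrank_range_add_finrank_ker (g.restrictScalars k)
    have h2 : LinearMap.range (g.restrictScalars k) = ⊤ := LinearMap.range_eq_top.2 hg
    rw [h2, finrank_top] at h1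
    have h3 : LinearMap.ker (g.restrictScalars k) ≠ ⊥ := fun h => hgi (LinearMap.ker_eq_bot (f := g.restrictScalars k) |>.1 h)
    have h4 := Submodule.one_le_finrank_iff.2 h3
    omega
  have : FiniteDimensional k (LinearMap.range f) :=
    Module.Finite.of_surjective (f.rangeRestrict.restrictScalars k) f.surjective_rangeRestrict
  have : FiniteDimensional k (M.carrier ⧸ LinearMap.range f) :=
    Module.Finite.of_surjective ((LinearMap.range f).mkQ.restrictScalars k)
      (LinearMap.range f).mkQ_surjective
  refine h₂.2.2.2 (FDMod.mk (LinearMap.range f)) M (FDMod.mk (M.carrier ⧸ LinearMap.range f))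
    (hq _ f.rangeRestrict f.surjective_rangeRestrict ?_)
    (hq _ (LinearMap.range f).mkQ (LinearMap.range f).mkQ_surjective ?_)
    (LinearMap.range f).subtype (LinearMap.range f).mkQ
    (LinearMap.range f).injective_subtype (LinearMap.range f).mkQ_surjective ?_
  · intro h
    exact hinj fun x y hxy => h (Subtype.ext hxy)
  · intro h
    have h5 := LinearMap.ker_eq_bot.2 h
    rw [Submodule.ker_mkQ] at h5
    exact hf0 (LinearMap.range_eq_bot.1 h5)
  · exact (Submodule.range_subtype _).trans (Submodule.ker_mkQ _).symm

/-- for torsion classes `T₁` and `T₂`, `T₁ ⊆ T₂` iff every brick in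
`T₁` lies in `T₂`; in particular `T₁ = T₂` iff they contain the same bricks. -/
theorem stmt13 (T₁ T₂ : Set (FDMod k R))
    (h₁ : IsTorsionClass k R T₁) (h₂ : IsTorsionClass k R T₂) :
    (T₁ ⊆ T₂ ↔ ∀ M : FDMod k R, IsBrick k R M → M ∈ T₁ → M ∈ T₂) ∧
    (T₁ = T₂ ↔ ∀ M : FDMod k R, IsBrick k R M → (M ∈ T₁ ↔ M ∈ T₂)) := by
  refine ⟨⟨fun h M _ hM => h hM, fun h M hM => torsion_aux k R T₁ T₂ h₁ h₂ h _ M rfl hM⟩,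
    fun h M _ => by rw [h], fun h => Set.Subset.antisymm ?_ ?_⟩
  · exact fun M hM => torsion_aux k R T₁ T₂ h₁ h₂ (fun M hB => (h M hB).1) _ M rfl hM
  · exact fun M hM => torsion_aux k R T₂ T₁ h₂ h₁ (fun M hB => (h M hB).2) _ M rfl hM
end

section
/- Let θ ∈ ℝ^n. Then T^θ = {M ∈ Mod(R) : ⟨θ, dim Q⟩ ≤ 0 for every quotient module Q of M} is a torsion class, and F^θ = {M ∈ Mod(R) : ⟨θ, dim N⟩ ≥ 0 for every submodule N of M} is a torsion-free class. -/
variable (k R : Type) [Field k] [Ring R] [Algebra k R]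

open Finset in
/-- The dimension vector of `M`: its `i`-th entry is `dim_k (e i • M)`
(the subspace `e i • M` is described as the `k`-span of `{e i • x : x ∈ M}`,
which coincides with it). -/
noncomputable def dimVec {m : ℕ} (e : Fin m → R) (M : FDMod k R) : Fin m → ℝ :=
  fun i =>
    (Module.finrank k
      (Submodule.span k (Set.range fun x : M.carrier => e i • x)) : ℝ)

section helpers
variable {k R}

theorem dv_span_eq (a : R) (M : FDMod k R) :
    Submodule.span k (Set.range fun x : M.carrier => a • x)
      = LinearMap.range (Algebra.lsmul k k M.carrier a) := by
  have : (Set.range fun x : M.carrier => a • x)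
      = (LinearMap.range (Algebra.lsmul k k M.carrier a) : Submodule k M.carrier) := by
    ext y; simp
  rw [this, Submodule.span_eq]

theorem dv_add (a : R) (ha : a * a = a) (A B C : FDMod k R)
    (f : A.carrier →ₗ[R] B.carrier) (g : B.carrier →ₗ[R] C.carrier)
    (hf : Function.Injective f) (hg : Function.Surjective g)
    (hfg : LinearMap.range f = LinearMap.ker g) :
    Module.finrank k (Submodule.span k (Set.range fun x : B.carrier => a • x)) =
    Module.finrank k (Submodule.span k (Set.range fun x : A.carrier => a • x)) +
    Module.finrank k (Submodule.span k (Set.range fun x : C.carrier => a • x)) := by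
  rw [dv_span_eq, dv_span_eq, dv_span_eq]
  set PA := LinearMap.range (Algebra.lsmul k k A.carrier a)
  set PB := LinearMap.range (Algebra.lsmul k k B.carrier a) with hPB
  set PC := LinearMap.range (Algebra.lsmul k k C.carrier a)
  have h1 := ((g.restrictScalars k).domRestrict PB).finrank_range_add_finrank_ker
  have h2 : LinearMap.range ((g.restrictScalars k).domRestrict PB) = PC := by
    ext y
    constructor
    · rintro ⟨⟨_, ⟨x, rfl⟩⟩, rfl⟩
      exact ⟨g x, by simp⟩
    · rintro ⟨z, rfl⟩
      obtain ⟨x, rfl⟩ := hg z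
      exact ⟨⟨_, ⟨x, rfl⟩⟩, by simp⟩
  have h3 : (LinearMap.ker ((g.restrictScalars k).domRestrict PB)).map PB.subtype
      = PA.map (f.restrictScalars k) := by
    ext y
    constructor
    · rintro ⟨⟨_, ⟨x, rfl⟩⟩, hx, rfl⟩
      have hx' : a • x ∈ LinearMap.ker g := by simpa using hx
      rw [← hfg] at hx'
      obtain ⟨z, hz⟩ := hx'
      refine ⟨a • z, ⟨z, rfl⟩, ?_⟩
      simp [hz, smul_smul, ha]
    · rintro ⟨_, ⟨x, rfl⟩, rfl⟩
      have hx : f x ∈ LinearMap.ker g := hfg ▸ ⟨x, rfl⟩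
      refine ⟨⟨a • f x, ⟨f x, rfl⟩⟩, ?_, by simp⟩
      have : g (f x) = 0 := hx
      simp [this]
  have h4 := Submodule.finrank_map_subtype_eq PB
    (LinearMap.ker ((g.restrictScalars k).domRestrict PB))
  have h5 := (Submodule.equivMapOfInjective (f.restrictScalars k) hf PA).finrank_eq
  rw [h3] at h4
  rw [h2] at h1
  omega

theorem dv_fd (M : FDMod k R) (S : Submodule R M.carrier) : FiniteDimensional k S :=
  inferInstanceAs (FiniteDimensional k (S.restrictScalars k))

theorem dv_fdq (M : FDMod k R) (S : Submodule R M.carrier) :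
    FiniteDimensional k (M.carrier ⧸ S) :=
  Module.Finite.of_surjective (S.mkQ.restrictScalars k) S.mkQ_surjective

/-- submodule as an object -/
def dvSub (M : FDMod k R) (S : Submodule R M.carrier) : FDMod k R :=
  haveI := dv_fd M S
  { carrier := S }

/-- quotient as an object -/
def dvQuot (M : FDMod k R) (S : Submodule R M.carrier) : FDMod k R :=
  haveI := dv_fdq M S
  { carrier := M.carrier ⧸ S }

theorem dv_theta {m : ℕ} (e : Fin m → R) (hidem : ∀ i, e i * e i = e i) (θ : Fin m → ℝ)
    (M : FDMod k R) (S : Submodule R M.carrier) :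
    ∑ i, θ i * dimVec k R e M i = ∑ i, θ i * dimVec k R e (dvSub M S) i +
      ∑ i, θ i * dimVec k R e (dvQuot M S) i := by
  rw [← Finset.sum_add_distrib]
  refine Finset.sum_congr rfl fun i _ => ?_
  rw [← mul_add]
  congr 1
  have := dv_add (e i) (hidem i) (dvSub M S) M (dvQuot M S) S.subtype S.mkQ
    S.subtype_injective S.mkQ_surjective (S.range_subtype.trans S.ker_mkQ.symm)
  unfold dimVec
  exact_mod_cast this

theorem dv_theta_zero {m : ℕ} (e : Fin m → R) (θ : Fin m → ℝ)
    (N : FDMod k R) (hN : Subsingleton N.carrier) :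
    ∑ i, θ i * dimVec k R e N i = 0 := by
  refine Finset.sum_eq_zero fun i _ => ?_
  have : Module.finrank k
      (Submodule.span k (Set.range fun x : N.carrier => e i • x)) = 0 :=
    Module.finrank_zero_of_subsingleton
  simp [dimVec, this]

end helpers

open Finset in
/-- for a complete set of orthogonal idempotents `e₁, …, eₘ` and
`θ ∈ ℝ^m`, the class `T^θ` of modules all of whose quotients `Q` satisfy
`⟨θ, dim Q⟩ ≤ 0` is a torsion class, and the class `F^θ` of modules all of whose
submodules `N` satisfy `⟨θ, dim N⟩ ≥ 0` is a torsion-free class. -/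
theorem stmt14 (m : ℕ) (e : Fin m → R)
    (hidem : ∀ i, e i * e i = e i)
    (horth : ∀ i j, i ≠ j → e i * e j = 0)
    (hsum : ∑ i, e i = 1)
    (θ : Fin m → ℝ) :
    IsTorsionClass k R
      {M : FDMod k R | ∀ (Q : FDMod k R) (f : M.carrier →ₗ[R] Q.carrier),
        Function.Surjective f → ∑ i, θ i * dimVec k R e Q i ≤ 0} ∧
    IsTorsionFreeClass k R
      {M : FDMod k R | ∀ (N : FDMod k R) (f : N.carrier →ₗ[R] M.carrier),
        Function.Injective f → 0 ≤ ∑ i, θ i * dimVec k R e N i} := by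
  refine ⟨⟨?_, ?_, ?_, ?_⟩, ⟨?_, ?_, ?_, ?_⟩⟩
  · rintro M N hM ⟨φ⟩ Q f hf
    exact hM Q (f.comp φ.toLinearMap) (hf.comp φ.surjective)
  · intro M hM Q f hf
    exact (dv_theta_zero e θ Q hf.subsingleton).le
  · intro M N hM φ hφ Q f hf
    exact hM Q (f.comp φ) (hf.comp hφ)
  · intro M₁ M₂ M₃ h₁ h₃ f g hf hg hfg Q h hh
    set S : Submodule R Q.carrier := LinearMap.range (h.comp f) with hS
    rw [dv_theta e hidem θ Q S]
    have a1 := h₁ (dvSub Q S) (h.comp f).rangeRestrict (h.comp f).surjective_rangeRestrict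
    have hle : LinearMap.ker g ≤ LinearMap.ker (S.mkQ.comp h) := by
      rw [← hfg]
      rintro _ ⟨x, rfl⟩
      have : h (f x) ∈ S := ⟨x, rfl⟩
      simpa using this
    let q : M₃.carrier →ₗ[R] (Q.carrier ⧸ S) :=
      ((LinearMap.ker g).liftQ (S.mkQ.comp h) hle).comp
        (g.quotKerEquivOfSurjective hg).symm.toLinearMap
    have hq : Function.Surjective q := by
      suffices hl : Function.Surjective ((LinearMap.ker g).liftQ (S.mkQ.comp h) hle) from
        hl.comp (g.quotKerEquivOfSurjective hg).symm.surjective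
      intro y
      obtain ⟨z, rfl⟩ := S.mkQ_surjective y
      obtain ⟨x, rfl⟩ := hh z
      exact ⟨(LinearMap.ker g).mkQ x, by simp⟩
    have a3 := h₃ (dvQuot Q S) q hq
    linarith
  · rintro M N hM ⟨φ⟩ Q f hf
    exact hM Q (φ.symm.toLinearMap.comp f) (φ.symm.injective.comp hf)
  · intro M hM N f hf
    exact (dv_theta_zero e θ N hf.subsingleton).ge
  · intro M N hM φ hφ Q f hf
    exact hM Q (φ.comp f) (hφ.comp hf)
  · intro M₁ M₂ M₃ h₁ h₃ f g hf hg hfg N h hh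
    set S : Submodule R N.carrier := LinearMap.ker (g.comp h) with hS
    rw [dv_theta e hidem θ N S]
    have a3 := h₃ (dvQuot N S) (S.liftQ (g.comp h) le_rfl)
      (LinearMap.ker_eq_bot.mp (Submodule.ker_liftQ_eq_bot _ _ _ le_rfl))
    let q : S →ₗ[R] M₁.carrier :=
      (LinearEquiv.ofInjective f hf).symm.toLinearMap.comp
        ((h.comp S.subtype).codRestrict (LinearMap.range f) (by
          intro c
          rw [hfg]
          exact c.2))
    have hq : Function.Injective q := by
      refine (LinearEquiv.ofInjective f hf).symm.injective.comp ?_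
      intro x y hxy
      exact Subtype.ext (hh (congrArg Subtype.val hxy))
    have a1 := h₁ (dvSub N S) q hq
    linarith
end

section
/- Let 𝕊 be a class of modules in Mod(R), and suppose X, Y ⊆ 𝕊 satisfy X = {M ∈ 𝕊 : Hom_R(M, N) = 0 for all N ∈ Y} and Y = {N ∈ 𝕊 : Hom_R(M, N) = 0 for all M ∈ X} (i.e., (X, Y) is a type 3 shadow). Then there exists a torsion pair (T, F) in Mod(R) such that X = T ∩ 𝕊 and Y = F ∩ 𝕊. -/
variable (k R : Type) [Field k] [Ring R] [Algebra k R]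

/-- For a class `C` of modules, `C^⊥ = {M : Hom(X, M) = 0 for all X ∈ C}`. -/
def rPerp (C : Set (FDMod k R)) : Set (FDMod k R) :=
  {M | ∀ X ∈ C, ∀ f : X.carrier →ₗ[R] M.carrier, f = 0}

/-- For a class `C` of modules, `^⊥C = {M : Hom(M, X) = 0 for all X ∈ C}`. -/
def lPerp (C : Set (FDMod k R)) : Set (FDMod k R) :=
  {M | ∀ X ∈ C, ∀ f : M.carrier →ₗ[R] X.carrier, f = 0}

/-- A torsion pair: a torsion class `T` and torsion-free class `F` with `F = T^⊥`
and `T = ^⊥F`. -/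
def IsTorsionPair (T F : Set (FDMod k R)) : Prop :=
  IsTorsionClass k R T ∧ IsTorsionFreeClass k R F ∧
    F = rPerp k R T ∧ T = lPerp k R F

theorem lPerp_torsion (C : Set (FDMod k R)) : IsTorsionClass k R (lPerp k R C) := by
  have hq : ∀ M N : FDMod k R, M ∈ lPerp k R C →
      ∀ f : M.carrier →ₗ[R] N.carrier, Function.Surjective f → N ∈ lPerp k R C := by
    intro M N hM f hf Z hZ h
    have h1 := hM Z hZ (h.comp f)
    ext y
    obtain ⟨x, rfl⟩ := hf y
    exact LinearMap.congr_fun h1 x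
  refine ⟨fun M N hM ⟨e⟩ => hq M N hM e.toLinearMap e.surjective, ?_, hq, ?_⟩
  · intro M hM Z hZ h
    ext x
    rw [Subsingleton.elim x 0, map_zero, map_zero]
  · intro M₁ M₂ M₃ h1 h3 f g hf hg hfg Z hZ h
    have e1 := h1 Z hZ (h.comp f)
    have hk : LinearMap.ker g ≤ LinearMap.ker h := by
      rw [← hfg]
      rintro _ ⟨x, rfl⟩
      exact LinearMap.congr_fun e1 x
    have e3 := h3 Z hZ (((LinearMap.ker g).liftQ h hk).comp
      (g.quotKerEquivOfSurjective hg).symm.toLinearMap)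
    ext x
    have := LinearMap.congr_fun e3 (g x)
    have hx : (g.quotKerEquivOfSurjective hg).symm (g x) = (LinearMap.ker g).mkQ x := by
      rw [LinearEquiv.symm_apply_eq]
      rfl
    simp only [LinearMap.comp_apply, LinearEquiv.coe_coe] at this
    rw [hx] at this
    simpa using this

theorem rPerp_torsionFree (C : Set (FDMod k R)) : IsTorsionFreeClass k R (rPerp k R C) := by
  have hq : ∀ M N : FDMod k R, M ∈ rPerp k R C →
      ∀ f : N.carrier →ₗ[R] M.carrier, Function.Injective f → N ∈ rPerp k R C := by
    intro M N hM f hf Z hZ h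
    have h1 := hM Z hZ (f.comp h)
    ext y
    apply hf
    rw [LinearMap.zero_apply, map_zero]
    exact LinearMap.congr_fun h1 y
  refine ⟨fun M N hM ⟨e⟩ => hq M N hM e.symm.toLinearMap e.symm.injective, ?_, hq, ?_⟩
  · intro M hM Z hZ h
    ext x
    exact Subsingleton.elim _ _
  · intro M₁ M₂ M₃ h1 h3 f g hf hg hfg Z hZ h
    have e3 := h3 Z hZ (g.comp h)
    have hk : ∀ z, h z ∈ LinearMap.range f := by
      intro z
      rw [hfg]
      exact LinearMap.congr_fun e3 z
    have e1 := h1 Z hZ ((LinearEquiv.ofInjective f hf).symm.toLinearMap.comp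
      (h.codRestrict _ hk))
    ext z
    have := LinearMap.congr_fun e1 z
    simp only [LinearMap.comp_apply, LinearEquiv.coe_coe, LinearMap.zero_apply] at this
    rw [LinearEquiv.symm_apply_eq, map_zero] at this
    exact congrArg Subtype.val this

/-- every type 3 shadow on a screen set `𝕊` comes from a torsion
pair: if `X = {M ∈ 𝕊 : Hom(M, N) = 0 ∀ N ∈ Y}` and
`Y = {N ∈ 𝕊 : Hom(M, N) = 0 ∀ M ∈ X}`, then there is a torsion pair `(T, F)` with
`X = T ∩ 𝕊` and `Y = F ∩ 𝕊`. -/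
theorem stmt17 (𝕊 X Y : Set (FDMod k R)) (hX𝕊 : X ⊆ 𝕊) (hY𝕊 : Y ⊆ 𝕊)
    (hX : X = {M ∈ 𝕊 | ∀ N ∈ Y, ∀ f : M.carrier →ₗ[R] N.carrier, f = 0})
    (hY : Y = {N ∈ 𝕊 | ∀ M ∈ X, ∀ f : M.carrier →ₗ[R] N.carrier, f = 0}) :
    ∃ T F : Set (FDMod k R),
      IsTorsionPair k R T F ∧ X = T ∩ 𝕊 ∧ Y = F ∩ 𝕊 := by
  have hYF : Y ⊆ rPerp k R (lPerp k R Y) := fun N hN M hM f => hM N hN f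
  have hXT : X ⊆ lPerp k R Y := by
    intro M hM
    rw [hX] at hM
    exact hM.2
  refine ⟨lPerp k R Y, rPerp k R (lPerp k R Y),
    ⟨lPerp_torsion k R _, rPerp_torsionFree k R _, rfl, ?_⟩, ?_, ?_⟩
  · apply Set.Subset.antisymm
    · exact fun M hM N hN f => hN M hM f
    · exact fun M hM N hN f => hM N (hYF hN) f
  · apply Set.Subset.antisymm
    · exact fun M hM => ⟨hXT hM, hX𝕊 hM⟩
    · intro M hM
      rw [hX]
      exact ⟨hM.2, hM.1⟩
  · apply Set.Subset.antisymm
    · exact fun M hM => ⟨hYF hM, hY𝕊 hM⟩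
    · intro N hN
      rw [hY]
      exact ⟨hN.2, fun M hM f => hN.1 M (hXT hM) f⟩
end
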